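/- On finite OP words, first-order logic has the three-variable property: every FO formula with at most one free variable over the signature (<, χ, monadic predicates for AP) is equivalent to a FO formula over the same signature using at most three distinct variables. -/

import Mathlib

noncomputable section

namespace OPLTheory

attribute [local instance] Classical.propDecidable

/-- The three operator precedence relations `⋖`, `≐`, `⋗`. -/
inductive Prec : Type where
  | lt : Prec
  | eq : Prec
  | gt : Prec

/-- An operator precedence matrix over alphabet `α`; the delimiter `#` is `none`. -/
abbrev OPM (α : Type) : Type := Option α → Option α → Option Prec

mutual
  /-- `Chain prec i j`: positions `i` and `j` are the left and right contexts of a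
      (simple or composed) chain, w.r.t. the precedence assignment `prec` on positions. -/
  inductive Chain (prec : ℕ → ℕ → Option Prec) : ℕ → ℕ → Prop where
    | mk {i k j : ℕ} : i < k → prec i k = some Prec.lt →
        Gap prec i k → Body prec k j → Chain prec i j
  /-- The body of a chain, from one of its terminals to the right context. -/
  inductive Body (prec : ℕ → ℕ → Option Prec) : ℕ → ℕ → Prop where
    | last {k j : ℕ} : k < j → prec k j = some Prec.gt → Gap prec k j → Body prec k j
    | step {k k' j : ℕ} : k < k' → prec k k' = some Prec.eq → Gap prec k k' →
        Body prec k' j → Body prec k j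
  /-- The gap between two consecutive terminals: empty or an inner chain. -/
  inductive Gap (prec : ℕ → ℕ → Option Prec) : ℕ → ℕ → Prop where
    | empty {a b : ℕ} : b = a + 1 → Gap prec a b
    | chain {a b : ℕ} : Chain prec a b → Gap prec a b
end

/-- A finite OP word: positions `0, …, n+1`, where `0` and `n+1` carry `#`. -/
structure OPWord (AP : Type) : Type where
  n : ℕ
  P : AP → Set ℕ

namespace OPWord

variable {AP : Type}

def lab (w : OPWord AP) (i : ℕ) : Option (Set AP) :=
  if i = 0 ∨ w.n + 1 ≤ i then none else some {a | i ∈ w.P a}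

def prec (w : OPWord AP) (M : OPM (Set AP)) (i j : ℕ) : Option Prec := M (w.lab i) (w.lab j)

def ltp (w : OPWord AP) (M : OPM (Set AP)) (i j : ℕ) : Prop := w.prec M i j = some Prec.lt
def eqp (w : OPWord AP) (M : OPM (Set AP)) (i j : ℕ) : Prop := w.prec M i j = some Prec.eq
def gtp (w : OPWord AP) (M : OPM (Set AP)) (i j : ℕ) : Prop := w.prec M i j = some Prec.gt

/-- The chain relation χ. -/
def chi (w : OPWord AP) (M : OPM (Set AP)) (i j : ℕ) : Prop :=
  i + 1 < j ∧ j ≤ w.n + 1 ∧ Chain (w.prec M) i j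

/-- Compatibility of a word with an OPM: consecutive letters and chain contexts
    have a defined precedence relation. -/
def Compatible (w : OPWord AP) (M : OPM (Set AP)) : Prop :=
  (∀ i, i ≤ w.n → (w.prec M i (i + 1)).isSome) ∧
  (∀ i j, j ≤ w.n + 1 → Chain (w.prec M) i j → (w.prec M i j).isSome)

end OPWord

/-- An OP ω-word: positions are all of `ℕ`; position `0` carries `#`. -/
structure OPWordW (AP : Type) : Type where
  P : AP → Set ℕ

namespace OPWordW

variable {AP : Type}

def lab (w : OPWordW AP) (i : ℕ) : Option (Set AP) :=
  if i = 0 then none else some {a | i ∈ w.P a}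

def prec (w : OPWordW AP) (M : OPM (Set AP)) (i j : ℕ) : Option Prec := M (w.lab i) (w.lab j)

def ltp (w : OPWordW AP) (M : OPM (Set AP)) (i j : ℕ) : Prop := w.prec M i j = some Prec.lt
def eqp (w : OPWordW AP) (M : OPM (Set AP)) (i j : ℕ) : Prop := w.prec M i j = some Prec.eq
def gtp (w : OPWordW AP) (M : OPM (Set AP)) (i j : ℕ) : Prop := w.prec M i j = some Prec.gt

def chi (w : OPWordW AP) (M : OPM (Set AP)) (i j : ℕ) : Prop :=
  i + 1 < j ∧ Chain (w.prec M) i j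

def Compatible (w : OPWordW AP) (M : OPM (Set AP)) : Prop :=
  (∀ i, (w.prec M i (i + 1)).isSome) ∧
  (∀ i j, Chain (w.prec M) i j → (w.prec M i j).isSome)

end OPWordW

/-- An abstract frame on which the temporal logics are interpreted:
    atomic satisfaction, the chain relation, the precedence of positions,
    and validity of positions (for finite words). -/
structure PFrame (AP : Type) : Type where
  atomSat : AP → ℕ → Prop
  chi : ℕ → ℕ → Prop
  pr : ℕ → ℕ → Option Prec
  valid : ℕ → Prop

namespace PFrame

variable {AP : Type} (F : PFrame AP)

def ltp (i j : ℕ) : Prop := F.pr i j = some Prec.lt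
def eqp (i j : ℕ) : Prop := F.pr i j = some Prec.eq
def gtp (i j : ℕ) : Prop := F.pr i j = some Prec.gt

/-- `i ⋖ j` or `i ≐ j` (used by downward operators). -/
def deq (i j : ℕ) : Prop := F.ltp i j ∨ F.eqp i j
/-- `i ⋗ j` or `i ≐ j` (used by upward operators). -/
def ueq (i j : ℕ) : Prop := F.gtp i j ∨ F.eqp i j

/-- Candidate chain-jumps of a downward summary path bounded by `bnd`. -/
def dspSet (bnd a : ℕ) : Set ℕ := {h | h ≤ bnd ∧ F.chi a h ∧ F.deq a h}

/-- One step of the downward summary path with final position `bnd`. -/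
def dspStep (bnd a b : ℕ) : Prop :=
  ((F.dspSet bnd a).Nonempty ∧ b = sSup (F.dspSet bnd a)) ∨
  (¬ (F.dspSet bnd a).Nonempty ∧ b = a + 1 ∧ F.deq a b)

def uspSet (bnd a : ℕ) : Set ℕ := {h | h ≤ bnd ∧ F.chi a h ∧ F.ueq a h}

def uspStep (bnd a b : ℕ) : Prop :=
  ((F.uspSet bnd a).Nonempty ∧ b = sSup (F.uspSet bnd a)) ∨
  (¬ (F.uspSet bnd a).Nonempty ∧ b = a + 1 ∧ F.ueq a b)

/-- An upward hierarchical path with common left context `h`. -/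
def IsUHP (h : ℕ) (l : List ℕ) : Prop :=
  l ≠ [] ∧ l.Chain' (· < ·) ∧ (∀ p ∈ l, F.chi h p ∧ F.ltp h p) ∧
  l.Chain' (fun a b => ¬ ∃ k, a < k ∧ k < b ∧ F.chi h k)

/-- A downward hierarchical path with common right context `h`. -/
def IsDHP (h : ℕ) (l : List ℕ) : Prop :=
  l ≠ [] ∧ l.Chain' (· < ·) ∧ (∀ p ∈ l, F.chi p h ∧ F.gtp p h) ∧
  l.Chain' (fun a b => ¬ ∃ k, a < k ∧ k < b ∧ F.chi k h)

end PFrame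

/-- `IsPath step l i j`: `l` is a path from `i` to `j` whose consecutive
    elements are related by `step`. -/
def IsPath (step : ℕ → ℕ → Prop) (l : List ℕ) (i j : ℕ) : Prop :=
  l.head? = some i ∧ l.getLast? = some j ∧ l.Chain' step

def OPWord.frame {AP : Type} (w : OPWord AP) (M : OPM (Set AP)) : PFrame AP where
  atomSat a i := i ∈ w.P a
  chi := w.chi M
  pr := w.prec M
  valid i := i ≤ w.n + 1

def OPWordW.frame {AP : Type} (w : OPWordW AP) (M : OPM (Set AP)) : PFrame AP where
  atomSat a i := i ∈ w.P a
  chi := w.chi M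
  pr := w.prec M
  valid _ := True

/-- Syntax of POTL. -/
inductive POTL (AP : Type) : Type where
  | tt : POTL AP
  | atom (a : AP) : POTL AP
  | neg (φ : POTL AP) : POTL AP
  | orf (φ ψ : POTL AP) : POTL AP
  | nextD (φ : POTL AP) : POTL AP
  | nextU (φ : POTL AP) : POTL AP
  | backD (φ : POTL AP) : POTL AP
  | backU (φ : POTL AP) : POTL AP
  | chiFD (φ : POTL AP) : POTL AP
  | chiFU (φ : POTL AP) : POTL AP
  | chiPD (φ : POTL AP) : POTL AP
  | chiPU (φ : POTL AP) : POTL AP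
  | untilD (φ ψ : POTL AP) : POTL AP
  | untilU (φ ψ : POTL AP) : POTL AP
  | sinceD (φ ψ : POTL AP) : POTL AP
  | sinceU (φ ψ : POTL AP) : POTL AP
  | hnextD (φ : POTL AP) : POTL AP
  | hnextU (φ : POTL AP) : POTL AP
  | hbackD (φ : POTL AP) : POTL AP
  | hbackU (φ : POTL AP) : POTL AP
  | huntilD (φ ψ : POTL AP) : POTL AP
  | huntilU (φ ψ : POTL AP) : POTL AP
  | hsinceD (φ ψ : POTL AP) : POTL AP
  | hsinceU (φ ψ : POTL AP) : POTL AP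

/-- Semantics of POTL on a frame. -/
def POTL.Sat {AP : Type} (F : PFrame AP) : POTL AP → ℕ → Prop
  | .tt, _ => True
  | .atom a, i => F.atomSat a i
  | .neg φ, i => ¬ POTL.Sat F φ i
  | .orf φ ψ, i => POTL.Sat F φ i ∨ POTL.Sat F ψ i
  | .nextD φ, i => F.valid (i + 1) ∧ F.deq i (i + 1) ∧ POTL.Sat F φ (i + 1)
  | .nextU φ, i => F.valid (i + 1) ∧ F.ueq i (i + 1) ∧ POTL.Sat F φ (i + 1)
  | .backD φ, i => 1 ≤ i ∧ F.deq (i - 1) i ∧ POTL.Sat F φ (i - 1)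
  | .backU φ, i => 1 ≤ i ∧ F.ueq (i - 1) i ∧ POTL.Sat F φ (i - 1)
  | .chiFD φ, i => ∃ j, F.chi i j ∧ F.deq i j ∧ POTL.Sat F φ j
  | .chiFU φ, i => ∃ j, F.chi i j ∧ F.ueq i j ∧ POTL.Sat F φ j
  | .chiPD φ, i => ∃ j, F.chi j i ∧ F.deq j i ∧ POTL.Sat F φ j
  | .chiPU φ, i => ∃ j, F.chi j i ∧ F.ueq j i ∧ POTL.Sat F φ j
  | .untilD φ ψ, i => ∃ j, i ≤ j ∧ F.valid j ∧ ∃ l, IsPath (F.dspStep j) l i j ∧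
      POTL.Sat F ψ j ∧ ∀ p ∈ l.dropLast, POTL.Sat F φ p
  | .untilU φ ψ, i => ∃ j, i ≤ j ∧ F.valid j ∧ ∃ l, IsPath (F.uspStep j) l i j ∧
      POTL.Sat F ψ j ∧ ∀ p ∈ l.dropLast, POTL.Sat F φ p
  | .sinceD φ ψ, i => ∃ j, j ≤ i ∧ ∃ l, IsPath (F.dspStep i) l j i ∧
      POTL.Sat F ψ j ∧ ∀ p ∈ l.tail, POTL.Sat F φ p
  | .sinceU φ ψ, i => ∃ j, j ≤ i ∧ ∃ l, IsPath (F.uspStep i) l j i ∧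
      POTL.Sat F ψ j ∧ ∀ p ∈ l.tail, POTL.Sat F φ p
  | .hnextU φ, i => ∃ h, h < i ∧ F.chi h i ∧ F.ltp h i ∧
      (∃ k, i < k ∧ F.chi h k ∧ F.ltp h k) ∧
      POTL.Sat F φ (sInf {k | i < k ∧ F.chi h k ∧ F.ltp h k})
  | .hbackU φ, i => ∃ h, h < i ∧ F.chi h i ∧ F.ltp h i ∧
      (∃ k, k < i ∧ F.chi h k ∧ F.ltp h k) ∧
      POTL.Sat F φ (sSup {k | k < i ∧ F.chi h k ∧ F.ltp h k})
  | .hnextD φ, i => ∃ h, i < h ∧ F.chi i h ∧ F.gtp i h ∧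
      (∃ k, i < k ∧ F.chi k h ∧ F.gtp k h) ∧
      POTL.Sat F φ (sInf {k | i < k ∧ F.chi k h ∧ F.gtp k h})
  | .hbackD φ, i => ∃ h, i < h ∧ F.chi i h ∧ F.gtp i h ∧
      (∃ k, k < i ∧ F.chi k h ∧ F.gtp k h) ∧
      POTL.Sat F φ (sSup {k | k < i ∧ F.chi k h ∧ F.gtp k h})
  | .huntilU φ ψ, i => ∃ h l j, h < i ∧ F.IsUHP h l ∧ l.head? = some i ∧
      l.getLast? = some j ∧ POTL.Sat F ψ j ∧ ∀ p ∈ l.dropLast, POTL.Sat F φ p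
  | .hsinceU φ ψ, i => ∃ h l j, h < j ∧ F.IsUHP h l ∧ l.getLast? = some i ∧
      l.head? = some j ∧ POTL.Sat F ψ j ∧ ∀ p ∈ l.tail, POTL.Sat F φ p
  | .huntilD φ ψ, i => ∃ h l j, j < h ∧ F.IsDHP h l ∧ l.head? = some i ∧
      l.getLast? = some j ∧ POTL.Sat F ψ j ∧ ∀ p ∈ l.dropLast, POTL.Sat F φ p
  | .hsinceD φ ψ, i => ∃ h l j, i < h ∧ F.IsDHP h l ∧ l.getLast? = some i ∧
      l.head? = some j ∧ POTL.Sat F ψ j ∧ ∀ p ∈ l.tail, POTL.Sat F φ p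

/-- Conjunction, as a derived POTL operator. -/
def POTL.andf {AP : Type} (φ ψ : POTL AP) : POTL AP := .neg (.orf (.neg φ) (.neg ψ))

/-- Syntax of OPTL. `suntil`/`ssince` take the set `Π ⊆ {⋖,≐,⋗}` of precedence
    relations allowed between consecutive positions. -/
inductive OPTL (AP : Type) : Type where
  | tt : OPTL AP
  | atom (a : AP) : OPTL AP
  | neg (φ : OPTL AP) : OPTL AP
  | orf (φ ψ : OPTL AP) : OPTL AP
  | next (φ : OPTL AP) : OPTL AP
  | back (φ : OPTL AP) : OPTL AP
  | luntil (φ ψ : OPTL AP) : OPTL AP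
  | lsince (φ ψ : OPTL AP) : OPTL AP
  | cnext (φ : OPTL AP) : OPTL AP
  | cback (φ : OPTL AP) : OPTL AP
  | suntil (pi : Set Prec) (φ ψ : OPTL AP) : OPTL AP
  | ssince (pi : Set Prec) (φ ψ : OPTL AP) : OPTL AP
  | hyuntil (φ ψ : OPTL AP) : OPTL AP
  | hysince (φ ψ : OPTL AP) : OPTL AP
  | htuntil (φ ψ : OPTL AP) : OPTL AP
  | htsince (φ ψ : OPTL AP) : OPTL AP

/-- One step of an OPTL summary-until path bounded by `bnd`. -/
def optlUStep {AP : Type} (F : PFrame AP) (pi : Set Prec) (bnd a b : ℕ) : Prop :=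
  (b ≤ bnd ∧ F.chi a b ∧ F.ueq a b) ∨
  ((¬ ∃ h, h ≤ bnd ∧ F.chi a h ∧ F.ueq a h) ∧ b = a + 1 ∧ ∃ π ∈ pi, F.pr a b = some π)

/-- One step of an OPTL summary-since path whose first position is `bnd`. -/
def optlSStep {AP : Type} (F : PFrame AP) (pi : Set Prec) (bnd a b : ℕ) : Prop :=
  (bnd ≤ a ∧ F.chi a b ∧ F.deq a b) ∨
  ((¬ ∃ h, bnd ≤ h ∧ F.chi h b ∧ F.deq h b) ∧ b = a + 1 ∧ ∃ π ∈ pi, F.pr a b = some π)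

/-- Semantics of OPTL on a frame. -/
def OPTL.Sat {AP : Type} (F : PFrame AP) : OPTL AP → ℕ → Prop
  | .tt, _ => True
  | .atom a, i => F.atomSat a i
  | .neg φ, i => ¬ OPTL.Sat F φ i
  | .orf φ ψ, i => OPTL.Sat F φ i ∨ OPTL.Sat F ψ i
  | .next φ, i => F.valid (i + 1) ∧ OPTL.Sat F φ (i + 1)
  | .back φ, i => 1 ≤ i ∧ OPTL.Sat F φ (i - 1)
  | .luntil φ ψ, i => ∃ j, i ≤ j ∧ F.valid j ∧ OPTL.Sat F ψ j ∧
      ∀ p, i ≤ p → p < j → OPTL.Sat F φ p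
  | .lsince φ ψ, i => ∃ j, j ≤ i ∧ OPTL.Sat F ψ j ∧
      ∀ p, j < p → p ≤ i → OPTL.Sat F φ p
  | .cnext φ, i => ∃ j, F.chi i j ∧ F.ueq i j ∧ OPTL.Sat F φ j
  | .cback φ, i => ∃ j, F.chi j i ∧ F.deq j i ∧ OPTL.Sat F φ j
  | .suntil pi φ ψ, i => ∃ j, i ≤ j ∧ F.valid j ∧
      ∃ l, IsPath (optlUStep F pi j) l i j ∧ OPTL.Sat F ψ j ∧
        ∀ p ∈ l.dropLast, OPTL.Sat F φ p
  | .ssince pi φ ψ, i => ∃ j, j ≤ i ∧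
      ∃ l, IsPath (optlSStep F pi j) l j i ∧ OPTL.Sat F ψ j ∧
        ∀ p ∈ l.tail, OPTL.Sat F φ p
  | .hyuntil φ ψ, i => ∃ l : List ℕ, l ≠ [] ∧ l.Chain' (· < ·) ∧
      (∀ p ∈ l, i < p ∧ F.chi i p ∧ F.ltp i p) ∧
      (∀ j1, l.head? = some j1 → ∀ k, k < j1 → ¬ F.chi i k) ∧
      (∀ jn, l.getLast? = some jn → OPTL.Sat F ψ jn) ∧
      (∀ p ∈ l.dropLast, OPTL.Sat F φ p)
  | .hysince φ ψ, i => ∃ l : List ℕ, l ≠ [] ∧ l.Chain' (· < ·) ∧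
      (∀ p ∈ l, i < p ∧ F.chi i p ∧ F.ltp i p) ∧
      (∀ jn, l.getLast? = some jn → ∀ k, jn < k → ¬ F.chi i k) ∧
      (∀ j1, l.head? = some j1 → OPTL.Sat F ψ j1) ∧
      (∀ p ∈ l.tail, OPTL.Sat F φ p)
  | .htuntil φ ψ, i => ∃ l : List ℕ, l ≠ [] ∧ l.Chain' (· < ·) ∧
      (∀ p ∈ l, p < i ∧ F.chi p i ∧ F.gtp p i) ∧
      (∀ jn, l.getLast? = some jn → ∀ k, jn < k → k < i → ¬ F.chi k i) ∧
      (∀ jn, l.getLast? = some jn → OPTL.Sat F ψ jn) ∧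
      (∀ p ∈ l.dropLast, OPTL.Sat F φ p)
  | .htsince φ ψ, i => ∃ l : List ℕ, l ≠ [] ∧ l.Chain' (· < ·) ∧
      (∀ p ∈ l, p < i ∧ F.chi p i ∧ F.gtp p i) ∧
      (∀ j1, l.head? = some j1 → ∀ k, k < j1 → ¬ F.chi k i) ∧
      (∀ j1, l.head? = some j1 → OPTL.Sat F ψ j1) ∧
      (∀ p ∈ l.tail, OPTL.Sat F φ p)

/-- The OP word determined by a list of letters (position `i+1` carries letter `i`). -/
def listWord {AP : Type} (w : List (Set AP)) : OPWord AP :=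
  ⟨w.length, fun a => {i | 1 ≤ i ∧ i ≤ w.length ∧ a ∈ w.getD (i - 1) ∅}⟩

def ListCompatible {AP : Type} (M : OPM (Set AP)) (w : List (Set AP)) : Prop :=
  (listWord w).Compatible M

/-- Satisfaction of a POTL formula at (0-based) letter position `i` of a list word. -/
def POTL.SatL {AP : Type} (M : OPM (Set AP)) (w : List (Set AP)) (i : ℕ) (φ : POTL AP) :
    Prop :=
  POTL.Sat ((listWord w).frame M) φ (i + 1)

/-- Satisfaction of an OPTL formula at (0-based) letter position `i` of a list word. -/
def OPTL.SatL {AP : Type} (M : OPM (Set AP)) (w : List (Set AP)) (i : ℕ) (φ : OPTL AP) :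
    Prop :=
  OPTL.Sat ((listWord w).frame M) φ (i + 1)

/-- An operator precedence automaton with states `Q` over `(Sig, M)`. -/
structure OPA (Sig Q : Type) (M : OPM Sig) : Type where
  I : Set Q
  F : Set Q
  push : Q → Sig → Q → Prop
  shift : Q → Sig → Q → Prop
  pop : Q → Q → Q → Prop

/-- A move of an OPA between configurations `(input, state, stack)`. -/
def OPA.step {Sig Q : Type} {M : OPM Sig} (A : OPA Sig Q M) :
    List Sig × Q × List (Sig × Q) → List Sig × Q × List (Sig × Q) → Prop := fun c c' =>
  (∃ a x p q γ, c = (a :: x, p, γ) ∧ M (γ.head?.map Prod.fst) (some a) = some Prec.lt ∧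
     A.push p a q ∧ c' = (x, q, (a, p) :: γ)) ∨
  (∃ b x q r a p γ, c = (b :: x, q, (a, p) :: γ) ∧ M (some a) (some b) = some Prec.eq ∧
     A.shift q b r ∧ c' = (x, r, (b, p) :: γ)) ∨
  (∃ x q r a p γ, c = (x, q, (a, p) :: γ) ∧ M (some a) x.head? = some Prec.gt ∧
     A.pop q p r ∧ c' = (x, r, γ))

def OPA.lang {Sig Q : Type} {M : OPM Sig} (A : OPA Sig Q M) : Set (List Sig) :=
  {x | ∃ qI ∈ A.I, ∃ qF ∈ A.F, Relation.ReflTransGen A.step (x, qI, []) ([], qF, [])}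

/-- `L` is an operator precedence language over `(Sig, M)`. -/
def IsOPL {Sig : Type} (M : OPM Sig) (L : Set (List Sig)) : Prop :=
  ∃ (n : ℕ) (A : OPA Sig (Fin n) M), L = A.lang

/-- `v^k`: the `k`-fold repetition of the string `v`. -/
def listPow {α : Type} (v : List α) : ℕ → List α
  | 0 => []
  | k + 1 => v ++ listPow v k


/-! ### The alphabet of procedural traces and the OPM `M_call` -/

/-- Atomic propositions: the structural labels `call`, `ret`, `han`, `exc`,
    plus the ordinary proposition `p_A`. -/
inductive CallAP : Type where
  | call : CallAP
  | ret : CallAP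
  | han : CallAP
  | exc : CallAP
  | pA : CallAP
deriving DecidableEq

/-- The matrix `M_call` on structural labels. -/
def callPrec : CallAP → CallAP → Option Prec
  | .call, .call => some Prec.lt
  | .call, .ret => some Prec.eq
  | .call, .han => some Prec.lt
  | .call, .exc => some Prec.gt
  | .ret, .call => some Prec.gt
  | .ret, .ret => some Prec.gt
  | .ret, .han => some Prec.gt
  | .ret, .exc => some Prec.gt
  | .han, .call => some Prec.lt
  | .han, .ret => some Prec.gt
  | .han, .han => some Prec.lt
  | .han, .exc => some Prec.eq
  | .exc, .call => some Prec.gt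
  | .exc, .ret => some Prec.gt
  | .exc, .han => some Prec.gt
  | .exc, .exc => some Prec.gt
  | _, _ => none

/-- The unique structural label of a label set, if it exists. -/
def theStruct (s : Set CallAP) : Option CallAP :=
  if h : ∃! x : CallAP, x ∈ s ∧ x ≠ CallAP.pA then some h.choose else none

/-- The OPM `M_call`, lifted to label sets containing exactly one structural label;
    `#` yields precedence to anything and anything takes precedence over `#`. -/
def Mcall : OPM (Set CallAP) := fun a b =>
  match a, b with
  | none, none => none
  | none, some t => (theStruct t).bind fun _ => some Prec.lt
  | some s, none => (theStruct s).bind fun _ => some Prec.gt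
  | some s, some t => (theStruct s).bind fun x => (theStruct t).bind fun y => callPrec x y

/-- The universe of words compatible with `M_call`. -/
def Lcall : Set (List (Set CallAP)) := {w | ListCompatible Mcall w}

/-! ### First-order logic with named variables over a relational signature -/

/-- First-order formulas with binary relation symbols `R`, unary predicates `U`,
    and variables `V`. -/
inductive FOV (R U V : Type) : Type where
  | fal : FOV R U V
  | rel (r : R) (x y : V) : FOV R U V
  | un (u : U) (x : V) : FOV R U V
  | eqv (x y : V) : FOV R U V
  | imp (f g : FOV R U V) : FOV R U V
  | all (x : V) (f : FOV R U V) : FOV R U V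

namespace FOV

variable {R U V D : Type}

def Realize [DecidableEq V] (relI : R → D → D → Prop) (unI : U → D → Prop) :
    FOV R U V → (V → D) → Prop
  | .fal, _ => False
  | .rel r x y, v => relI r (v x) (v y)
  | .un u x, v => unI u (v x)
  | .eqv x y, v => v x = v y
  | .imp f g, v => Realize relI unI f v → Realize relI unI g v
  | .all x f, v => ∀ d : D, Realize relI unI f (Function.update v x d)

/-- Quantifier rank. -/
def qr : FOV R U V → ℕ
  | .fal => 0
  | .rel _ _ _ => 0
  | .un _ _ => 0
  | .eqv _ _ => 0
  | .imp f g => max f.qr g.qr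
  | .all _ f => f.qr + 1

/-- Free variables. -/
def free : FOV R U V → Set V
  | .fal => ∅
  | .rel _ x y => {x, y}
  | .un _ x => {x}
  | .eqv x y => {x, y}
  | .imp f g => f.free ∪ g.free
  | .all x f => f.free \ {x}

end FOV

/-- The relational signature of OP words: the linear order and the chain relation. -/
inductive OPRel : Type where
  | ord : OPRel
  | chain : OPRel

/-- Interpretation of the OP word signature on the positions of a finite OP word. -/
def wordRelI {AP : Type} (M : OPM (Set AP)) (w : OPWord AP) :
    OPRel → Fin (w.n + 2) → Fin (w.n + 2) → Prop
  | .ord => fun a b => (a : ℕ) < (b : ℕ)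
  | .chain => fun a b => w.chi M a b

def wordUnI {AP : Type} (w : OPWord AP) : AP → Fin (w.n + 2) → Prop :=
  fun a p => (p : ℕ) ∈ w.P a

/-- Interpretation of the OP word signature on the positions of an OP ω-word. -/
def wordRelIW {AP : Type} (M : OPM (Set AP)) (w : OPWordW AP) : OPRel → ℕ → ℕ → Prop
  | .ord => fun a b => a < b
  | .chain => fun a b => w.chi M a b

def wordUnIW {AP : Type} (w : OPWordW AP) : AP → ℕ → Prop := fun a p => p ∈ w.P a

/-! ### Unranked ordered trees -/

/-- An unranked ordered tree: nodes are sequences of child numbers; `hash` is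
    the set of nodes labeled with the delimiter `#`. -/
structure UOT (AP : Type) : Type where
  S : Set (List ℕ)
  hash : Set (List ℕ)
  L : AP → Set (List ℕ)

/-- The child relation `R_⇓`. -/
def rdown (s t : List ℕ) : Prop := ∃ k : ℕ, t = s ++ [k]

/-- The next-sibling relation `R_⇒`. -/
def rright (s t : List ℕ) : Prop := ∃ (r : List ℕ) (h : ℕ), s = r ++ [h] ∧ t = r ++ [h + 1]

namespace UOT

variable {AP : Type}

def nodeLab (T : UOT AP) (s : List ℕ) : Option (Set AP) :=
  if s ∈ T.hash then none else some {a | s ∈ T.L a}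

def prec (T : UOT AP) (M : OPM (Set AP)) (s t : List ℕ) : Option Prec :=
  M (T.nodeLab s) (T.nodeLab t)

end UOT

/-- `t` is the rightmost child of `s` (in the node set of `T`). -/
def RightmostChild {AP : Type} (T : UOT AP) (s t : List ℕ) : Prop :=
  t ∈ T.S ∧ rdown s t ∧ ¬ ∃ u ∈ T.S, rright t u

/-- The right context `Rc` of a node: its leftmost right sibling, or recursively the
    `Rc` of its parent; undefined if the node has a child in the `≐` relation with it. -/
inductive RcRel {AP : Type} (M : OPM (Set AP)) (T : UOT AP) : List ℕ → List ℕ → Prop where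
  | sib {r : List ℕ} {h : ℕ} :
      (¬ ∃ c, rdown (r ++ [h]) c ∧ c ∈ T.S ∧ T.prec M (r ++ [h]) c = some Prec.eq) →
      r ++ [h + 1] ∈ T.S →
      RcRel M T (r ++ [h]) (r ++ [h + 1])
  | up {r : List ℕ} {h : ℕ} {x : List ℕ} :
      (¬ ∃ c, rdown (r ++ [h]) c ∧ c ∈ T.S ∧ T.prec M (r ++ [h]) c = some Prec.eq) →
      r ++ [h + 1] ∉ T.S →
      RcRel M T r x →
      RcRel M T (r ++ [h]) x

/-- OPM-compatibility of a UOT (membership in `𝒯_M`). -/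
def UOT.CompatibleM {AP : Type} (T : UOT AP) (M : OPM (Set AP)) : Prop :=
  (∀ s ∈ T.S, (s ∈ T.hash ↔ s = [] ∨ RightmostChild T [] s)) ∧
  (∀ s c, s ∈ T.S → RightmostChild T s c →
    (T.prec M s c = some Prec.lt ∨ T.prec M s c = some Prec.eq)) ∧
  (∀ s c, s ∈ T.S → c ∈ T.S → rdown s c → ¬ RightmostChild T s c →
    T.prec M s c = some Prec.lt) ∧
  (∀ s r, s ∈ T.S → RcRel M T s r → T.prec M s r = some Prec.gt)

/-- `χ(i,j)` with `i ⋖ j` or `i ≐ j` (finite words). -/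
def chiDeq {AP : Type} (w : OPWord AP) (M : OPM (Set AP)) (i j : ℕ) : Prop :=
  w.chi M i j ∧ (w.ltp M i j ∨ w.eqp M i j)

/-- `tau` is the map `τ` from the positions of the finite OP word `w` to the nodes of
    the unranked ordered tree `T = τ(w)`. -/
def IsTauMap {AP : Type} (M : OPM (Set AP)) (w : OPWord AP) (T : UOT AP)
    (tau : ℕ → List ℕ) : Prop :=
  tau 0 = [] ∧
  T.S = {s | ∃ i, i ≤ w.n + 1 ∧ tau i = s} ∧
  T.hash = {s | tau 0 = s ∨ tau (w.n + 1) = s} ∧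
  (∀ a, T.L a = {s | ∃ i, i ≤ w.n + 1 ∧ tau i = s ∧ i ∈ w.P a}) ∧
  ∀ i, i ≤ w.n →
    ((w.eqp M i (i + 1) ∨ w.ltp M i (i + 1)) → tau (i + 1) = tau i ++ [0]) ∧
    (w.eqp M i (i + 1) → ∀ j, j ≤ w.n + 1 → rdown (tau i) (tau j) → tau j = tau (i + 1)) ∧
    (w.gtp M i (i + 1) → ∀ j, j ≤ w.n + 1 → ¬ rdown (tau i) (tau j)) ∧
    (∀ j, chiDeq w M i j →
      tau j = tau i ++ [{j' | chiDeq w M i j' ∧ j' < j}.ncard + 1])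

/-- `χ(i,j)` with `i ⋖ j` or `i ≐ j` (ω-words). -/
def chiDeqW {AP : Type} (w : OPWordW AP) (M : OPM (Set AP)) (i j : ℕ) : Prop :=
  w.chi M i j ∧ (w.ltp M i j ∨ w.eqp M i j)

/-- `tau` is the map `τ` from the positions of the OP ω-word `w` to the nodes of
    the unranked ordered tree `T = τ(w)`. -/
def IsTauMapW {AP : Type} (M : OPM (Set AP)) (w : OPWordW AP) (T : UOT AP)
    (tau : ℕ → List ℕ) : Prop :=
  tau 0 = [] ∧
  T.S = Set.range tau ∧
  T.hash = {s | tau 0 = s} ∧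
  (∀ a, T.L a = {s | ∃ i, tau i = s ∧ i ∈ w.P a}) ∧
  ∀ i,
    ((w.eqp M i (i + 1) ∨ w.ltp M i (i + 1)) → tau (i + 1) = tau i ++ [0]) ∧
    (w.eqp M i (i + 1) → ∀ j, rdown (tau i) (tau j) → tau j = tau (i + 1)) ∧
    (w.gtp M i (i + 1) → ∀ j, ¬ rdown (tau i) (tau j)) ∧
    (∀ j, chiDeqW w M i j →
      tau j = tau i ++ [{j' | chiDeqW w M i j' ∧ j' < j}.ncard + 1])

/-- `T` is right-recursive, with `f` enumerating the pending nodes obtained by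
    descending through rightmost children from the root. -/
def IsRR {AP : Type} (T : UOT AP) (f : ℕ → List ℕ) : Prop :=
  f 0 = [] ∧ ∀ p, RightmostChild T (f p) (f (p + 1))

/-- `T` is left-recursive, with `g` the node `r_∞` with infinitely many children,
    reached from the root by descending through rightmost children. -/
def IsLR {AP : Type} (T : UOT AP) (g : List ℕ) : Prop :=
  (∃ (m : ℕ) (br : ℕ → List ℕ), br 0 = [] ∧ br m = g ∧
    ∀ p, p < m → RightmostChild T (br p) (br (p + 1))) ∧
  (∀ k : ℕ, g ++ [k] ∈ T.S)

/-- `t^R_w(s^R_p)`: the finite subtree rooted at the pending node `f p`, with the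
    subtree rooted at its rightmost child `f (p+1)` removed. -/
def rrSubtree {AP : Type} (T : UOT AP) (f : ℕ → List ℕ) (p : ℕ) : Set (List ℕ) :=
  {t | t ∈ T.S ∧ f p <+: t ∧ ¬ f (p + 1) <+: t}

/-- `t^L(w,p)`: the finite subtree rooted at the `p`-th child of `r_∞ = g`. -/
def lrSubtree {AP : Type} (T : UOT AP) (g : List ℕ) (p : ℕ) : Set (List ℕ) :=
  {t | t ∈ T.S ∧ (g ++ [p]) <+: t}

/-- `t_f(w)`: the finite tree obtained by removing all children of `r_∞ = g`
    (and their descendants). -/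
def lrTf {AP : Type} (T : UOT AP) (g : List ℕ) : Set (List ℕ) :=
  {t | t ∈ T.S ∧ ¬ ∃ k : ℕ, (g ++ [k]) <+: t}

/-- The relational signature of unranked ordered trees. -/
inductive TreeRel : Type where
  | down : TreeRel
  | right : TreeRel

/-- Interpretation of the tree signature on a set `A` of nodes. -/
def treeRelI (A : Set (List ℕ)) : TreeRel → ↥A → ↥A → Prop
  | .down => fun s t => rdown s.val t.val
  | .right => fun s t => rright s.val t.val

def treeUnI {AP : Type} (T : UOT AP) (A : Set (List ℕ)) : AP → ↥A → Prop :=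
  fun a s => s.val ∈ T.L a

/-- `≡_k` for sentences, between two structures over the same signature. -/
def EquivKSent (R U : Type) {D1 D2 : Type}
    (rel1 : R → D1 → D1 → Prop) (un1 : U → D1 → Prop)
    (rel2 : R → D2 → D2 → Prop) (un2 : U → D2 → Prop) (k : ℕ) : Prop :=
  ∀ φ : FOV R U ℕ, φ.free = ∅ → φ.qr ≤ k →
    ((∀ v, φ.Realize rel1 un1 v) ↔ (∀ v, φ.Realize rel2 un2 v))

/-- `≡_k` between two structures with a distinguished element. -/
def EquivKPt (R U : Type) {D1 D2 : Type}
    (rel1 : R → D1 → D1 → Prop) (un1 : U → D1 → Prop) (a : D1)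
    (rel2 : R → D2 → D2 → Prop) (un2 : U → D2 → Prop) (b : D2) (k : ℕ) : Prop :=
  ∀ φ : FOV R U ℕ, φ.free ⊆ {0} → φ.qr ≤ k →
    (φ.Realize rel1 un1 (fun _ => a) ↔ φ.Realize rel2 un2 (fun _ => b))

/-- The rank-`k` type of the tree structure induced by `T` on the node set `A`. -/
def rankType (AP : Type) (k : ℕ) (T : UOT AP) (A : Set (List ℕ)) :
    Set (FOV TreeRel AP ℕ) :=
  {φ | φ.free = ∅ ∧ φ.qr ≤ k ∧ ∀ v, φ.Realize (treeRelI A) (treeUnI T A) v}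

/-! ### The tree logic `X_until` -/

inductive Xuntil (AP : Type) : Type where
  | tt : Xuntil AP
  | atom (a : AP) : Xuntil AP
  | neg (φ : Xuntil AP) : Xuntil AP
  | andf (φ ψ : Xuntil AP) : Xuntil AP
  | down (φ ψ : Xuntil AP) : Xuntil AP
  | up (φ ψ : Xuntil AP) : Xuntil AP
  | right (φ ψ : Xuntil AP) : Xuntil AP
  | left (φ ψ : Xuntil AP) : Xuntil AP

/-- Strict semantics of `X_until` on a UOT. -/
def XSat {AP : Type} (T : UOT AP) : Xuntil AP → List ℕ → Prop
  | .tt, _ => True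
  | .atom a, s => s ∈ T.L a
  | .neg φ, s => ¬ XSat T φ s
  | .andf φ ψ, s => XSat T φ s ∧ XSat T ψ s
  | .down φ ψ, s => ∃ t ∈ T.S, s <+: t ∧ s ≠ t ∧ XSat T ψ t ∧
      ∀ r ∈ T.S, s <+: r → s ≠ r → r <+: t → r ≠ t → XSat T φ r
  | .up φ ψ, s => ∃ t ∈ T.S, t <+: s ∧ t ≠ s ∧ XSat T ψ t ∧
      ∀ r ∈ T.S, t <+: r → t ≠ r → r <+: s → r ≠ s → XSat T φ r
  | .right φ ψ, s => ∃ (r : List ℕ) (h h' : ℕ), s = r ++ [h] ∧ h < h' ∧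
      r ++ [h'] ∈ T.S ∧ XSat T ψ (r ++ [h']) ∧
      ∀ h'', h < h'' → h'' < h' → XSat T φ (r ++ [h''])
  | .left φ ψ, s => ∃ (r : List ℕ) (h h' : ℕ), s = r ++ [h] ∧ h' < h ∧
      r ++ [h'] ∈ T.S ∧ XSat T ψ (r ++ [h']) ∧
      ∀ h'', h' < h'' → h'' < h → XSat T φ (r ++ [h''])

/-- The subtree of `T_w` rooted at `r`, from which the subtree rooted at `r`'s
    rightmost child has been erased in case `α` holds at that child. -/
def prunedSubtree {AP : Type} (T : UOT AP) (α : Xuntil AP) (r : List ℕ) :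
    Set (List ℕ) :=
  {t | t ∈ T.S ∧ r <+: t ∧ ¬ ∃ c, RightmostChild T r c ∧ XSat T α c ∧ c <+: t}

/-! ### Derived POTL operators -/

section Derived

variable {AP : Type} [Fintype AP]

def bigOr (l : List (POTL AP)) : POTL AP := l.foldr POTL.orf (POTL.neg POTL.tt)
def bigAnd (l : List (POTL AP)) : POTL AP := l.foldr POTL.andf POTL.tt

/-- `σ_a`: exactly the propositions in `a` hold. -/
def sigmaF (a : Set AP) : POTL AP :=
  POTL.andf (bigAnd ((Finset.univ.filter (· ∈ a)).toList.map POTL.atom))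
    (bigAnd ((Finset.univ.filter (· ∉ a)).toList.map fun p => POTL.neg (POTL.atom p)))

/-- All pairs of label sets in the precedence relation `π`. -/
def pairsWith (M : OPM (Set AP)) (π : Prec) : List (Set AP × Set AP) :=
  (Finset.univ.filter
    (fun ab : Set AP × Set AP => M (some ab.1) (some ab.2) = some π)).toList

/-- `χ_F^π γ`: the restriction of `χ_F^d γ` to chains with contexts in `π ∈ {⋖,≐}`. -/
def chiFpi (M : OPM (Set AP)) (π : Prec) (γ : POTL AP) : POTL AP :=
  bigOr ((pairsWith M π).map fun ab =>
    POTL.andf (sigmaF ab.1) (POTL.chiFD (POTL.andf (sigmaF ab.2) γ)))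

/-- `χ_P^π γ`. -/
def chiPpi (M : OPM (Set AP)) (π : Prec) (γ : POTL AP) : POTL AP :=
  bigOr ((pairsWith M π).map fun ab =>
    POTL.andf (sigmaF ab.2) (POTL.chiPD (POTL.andf (sigmaF ab.1) γ)))

/-- `○^⋖ γ`: downward next restricted to the `⋖` relation. -/
def nextLt (M : OPM (Set AP)) (γ : POTL AP) : POTL AP :=
  bigOr ((pairsWith M Prec.lt).map fun ab =>
    POTL.andf (sigmaF ab.1) (POTL.nextD (POTL.andf (sigmaF ab.2) γ)))

/-- `⊖^⋖ γ`: downward back restricted to the `⋖` relation. -/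
def backLt (M : OPM (Set AP)) (γ : POTL AP) : POTL AP :=
  bigOr ((pairsWith M Prec.lt).map fun ab =>
    POTL.andf (sigmaF ab.2) (POTL.backD (POTL.andf (sigmaF ab.1) γ)))

end Derived

end OPLTheory

namespace OPLTheory

section

section ChainNC
variable {prec : ℕ → ℕ → Option Prec}

def EqS (prec : ℕ → ℕ → Option Prec) (a b : ℕ) : Prop :=
  a < b ∧ prec a b = some Prec.eq ∧ Gap prec a b

theorem body_decomp {k j : ℕ} (h : Body prec k j) :
    ∃ l, Relation.ReflTransGen (EqS prec) k l ∧ l < j ∧ prec l j = some Prec.gt ∧ Gap prec l j := by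
  refine Body.rec (prec := prec) (motive_1 := fun _ _ _ => True)
    (motive_2 := fun k j _ => ∃ l, Relation.ReflTransGen (EqS prec) k l ∧ l < j ∧
      prec l j = some Prec.gt ∧ Gap prec l j)
    (motive_3 := fun _ _ _ => True) ?_ ?_ ?_ ?_ ?_ h
  · intros; trivial
  · intro k j h1 h2 h3 _
    exact ⟨k, .refl, h1, h2, h3⟩
  · rintro k k' j h1 h2 h3 _ _ ⟨l, hl, r⟩
    exact ⟨l, .head ⟨h1, h2, h3⟩ hl, r⟩
  · intros; trivial
  · intros; trivial

/-- `p` is the left context of the handle whose last terminal is `l`. -/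
def Hd (prec : ℕ → ℕ → Option Prec) (p l : ℕ) : Prop :=
  ∃ k, p < k ∧ prec p k = some Prec.lt ∧ Gap prec p k ∧ Relation.ReflTransGen (EqS prec) k l

theorem chain_decomp {i j : ℕ} (h : Chain prec i j) :
    ∃ l, Hd prec i l ∧ l < j ∧ prec l j = some Prec.gt ∧ Gap prec l j := by
  cases h with
  | mk h1 h2 h3 h4 =>
    obtain ⟨l, a, b⟩ := body_decomp h4
    exact ⟨l, ⟨_, h1, h2, h3, a⟩, b⟩

theorem rtg_le {k l : ℕ} (h : Relation.ReflTransGen (EqS prec) k l) : k ≤ l := by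
  induction h with
  | refl => exact le_rfl
  | tail _ h ih => exact ih.trans h.1.le

theorem Hd.lt {p l : ℕ} (h : Hd prec p l) : p < l := by
  obtain ⟨k, h1, _, _, h4⟩ := h
  exact lt_of_lt_of_le h1 (rtg_le h4)

theorem chain_lt {i j : ℕ} (h : Chain prec i j) : i + 1 < j := by
  obtain ⟨l, h1, h2, _⟩ := chain_decomp h
  have := h1.lt
  omega

theorem gap_lt {i j : ℕ} (h : Gap prec i j) : i < j := by
  cases h with
  | empty h => omega
  | chain h => have := chain_lt h; omega

def LinAt (prec : ℕ → ℕ → Option Prec) (j : ℕ) : Prop :=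
  ∀ p q, Gap prec p j → Gap prec q j → p < q → prec q j = some Prec.gt

theorem par_unique {c a b : ℕ} (h : LinAt prec c) (ha : Gap prec a c) (hb : Gap prec b c)
    (ha' : prec a c ≠ some Prec.gt) (hb' : prec b c ≠ some Prec.gt) : a = b := by
  rcases lt_trichotomy a b with h1 | h1 | h1
  · exact absurd (h _ _ ha hb h1) hb'
  · exact h1
  · exact absurd (h _ _ hb ha h1) ha'

theorem hd_unique {l p q : ℕ} (hl : ∀ c ≤ l, LinAt prec c)
    (hp : Hd prec p l) (hq : Hd prec q l) : p = q := by
  obtain ⟨k, h1, h2, h3, h4⟩ := hp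
  induction h4 generalizing q with
  | refl =>
    obtain ⟨k2, g1, g2, g3, g4⟩ := hq
    rcases Relation.ReflTransGen.cases_tail g4 with e | ⟨b, _, e⟩
    · subst e
      exact par_unique (hl _ le_rfl) h3 g3 (by simp [h2]) (by simp [g2])
    · have := par_unique (hl _ le_rfl) h3 e.2.2 (by simp [h2]) (by simp [e.2.1])
      subst this
      have := e.2.1
      simp [h2] at this
  | tail h5 h6 ih =>
    obtain ⟨k2, g1, g2, g3, g4⟩ := hq
    rcases Relation.ReflTransGen.cases_tail g4 with e | ⟨b, g5, e⟩
    · subst e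
      have := par_unique (hl _ le_rfl) g3 h6.2.2 (by simp [g2]) (by simp [h6.2.1])
      subst this
      have := h6.2.1
      simp [g2] at this
    · have := par_unique (hl _ le_rfl) e.2.2 h6.2.2 (by simp [e.2.1]) (by simp [h6.2.1])
      subst this
      exact ih (fun c hc => hl c (hc.trans h6.1.le)) ⟨k2, g1, g2, g3, g5⟩

theorem no_conf {j : ℕ} (hl : ∀ c < j, LinAt prec c) :
    ∀ N p q l : ℕ, 2 * j - p - q ≤ N → Hd prec p l → l < j → prec l j = some Prec.gt →
      Gap prec l j → p < q → q < l → Gap prec q j → False := by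
  intro N
  induction N with
  | zero => intros; omega
  | succ N ih =>
    intro p q l hN h1 h2 h3 h4 h5 h6 h7
    cases h7 with
    | empty h => omega
    | chain h =>
      obtain ⟨l2, g1, g2, g3, g4⟩ := chain_decomp h
      have := g1.lt
      rcases lt_trichotomy l2 l with e | e | e
      · exact ih p l2 l (by omega) h1 h2 h3 h4 (by omega) e g4
      · subst e
        have := hd_unique (fun c hc => hl c (by omega)) h1 g1
        omega
      · exact ih q l l2 (by omega) g1 g2 g3 g4 h6 e h4

theorem linAt (j : ℕ) : LinAt prec j := by
  induction j using Nat.strong_induction_on with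
  | _ j ihj =>
  intro p q hp hq hpq
  have hqj := gap_lt hq
  suffices H : ∀ N p, j - p ≤ N → Gap prec p j → p < q → prec q j = some Prec.gt from
    H _ p le_rfl hp hpq
  intro N
  induction N with
  | zero => intros; omega
  | succ N ih =>
    intro p hN hp hpq
    cases hp with
    | empty h => omega
    | chain h =>
      obtain ⟨l, h1, h2, h3, h4⟩ := chain_decomp h
      have := h1.lt
      rcases lt_trichotomy l q with e | e | e
      · exact ih l (by omega) h4 e
      · subst e; exact h3
      · exact (no_conf ihj _ p q l le_rfl h1 h2 h3 h4 hpq e hq).elim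

theorem rtg_mid {k l : ℕ} (h : Relation.ReflTransGen (EqS prec) k l) (j : ℕ) (h1 : k < j)
    (h2 : j ≤ l) : (∃ p, k ≤ p ∧ EqS prec p j) ∨
      ∃ a b, k ≤ a ∧ a < j ∧ j < b ∧ b ≤ l ∧ Gap prec a b := by
  induction h with
  | refl => omega
  | @tail b c hb hc ih =>
    have := rtg_le hb
    rcases le_or_gt j b with e | e
    · rcases ih e with h | ⟨a, b', h⟩
      · exact .inl h
      · have := hc.1
        exact .inr ⟨a, b', by tauto, by tauto, by tauto, by omega, by tauto⟩
    · rcases Nat.lt_or_ge j c with e2 | e2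
      · exact .inr ⟨b, c, this, e, e2, le_rfl, hc.2.2⟩
      · obtain rfl : j = c := by omega
        exact .inl ⟨b, this, hc⟩

theorem chain_nc : ∀ N i j h k : ℕ, k - h ≤ N → Chain prec i j → Chain prec h k →
    i < h → h < j → j < k → False := by
  intro N
  induction N with
  | zero => intros; omega
  | succ N ih =>
    intro i j h k hN hij hhk h1 h2 h3
    have key : ∀ a, i < a → Gap prec a j → prec a j ≠ some Prec.gt → False := by
      intro a h4 h5 h6
      exact h6 (linAt j i a (.chain hij) h5 h4)
    have inn : ∀ a b, h ≤ a → a < j → j < b → b ≤ k → b - a < k - h → Gap prec a b → False := by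
      intro a b h4 h5 h6 h7 h8 h9
      cases h9 with
      | empty h => omega
      | chain g => exact ih i j a b (by omega) hij g (by omega) h5 h6
    obtain ⟨l, ⟨s, g1, g2, g3, g4⟩, g5, g6, g7⟩ := chain_decomp hhk
    have := rtg_le g4
    rcases lt_trichotomy j s with e | e | e
    · exact inn h s le_rfl h2 e (by omega) (by omega) g3
    · subst e
      exact key h h1 g3 (by simp [g2])
    · rcases le_or_gt j l with e2 | e2
      · rcases rtg_mid g4 j e e2 with ⟨p, q1, q2⟩ | ⟨a, b, q1, q2, q3, q4, q5⟩
        · exact key p (by omega) q2.2.2 (by simp [q2.2.1])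
        · exact inn a b (by omega) q2 q3 (by omega) (by omega) q5
      · exact inn l k (by omega) e2 h3 le_rfl (by omega) g7

end ChainNC

end

section

/-- Finite linear orders with a noncrossing relation and unary predicates. -/
structure NC (AP : Type) where
  N : ℕ
  ch : Fin (N + 1) → Fin (N + 1) → Prop
  P : AP → Fin (N + 1) → Prop
  len : ∀ x y, ch x y → x.val + 1 < y.val
  nc : ∀ x y u v, ch x y → ch u v → x < u → u < y → y < v → False

namespace NC
variable {AP : Type}

abbrev Dom (A : NC AP) : Type := Fin (A.N + 1)

def L (A : NC AP) (x y : A.Dom) : Prop :=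
  x < y ∧ ∀ v, x < v → v ≤ y → ∀ u, u < x → ¬ A.ch u v

def B (A : NC AP) (x y : A.Dom) : Prop := x < y ∧ ∀ p, A.L p x → A.L p y

def D (A : NC AP) (d : Bool) (x y : A.Dom) : Prop := A.B x y ∧ (d = true ↔ A.L x y)

def Mk (A : NC AP) (x : A.Dom) : Prop := ∃ j, A.ch x j ∧ ¬ A.L x j

variable {A : NC AP} {x y z p : A.Dom} {d e : Bool}

theorem L_int (h : A.L x y) (h1 : x < z) (h2 : z ≤ y) : A.L x z :=
  ⟨h1, fun v h3 h4 => h.2 v h3 (h4.trans h2)⟩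

theorem L_trans (h : A.L x y) (h1 : A.L y z) : A.L x z := by
  refine ⟨h.1.trans h1.1, fun v h3 h4 u hu => ?_⟩
  rcases le_or_gt v y with h5 | h5
  · exact h.2 v h3 h5 u hu
  · exact h1.2 v h5 h4 u (hu.trans h.1)

theorem L_B (h : A.L x y) : A.B x y := ⟨h.1, fun _ hp => L_trans hp h⟩

theorem B_trans (h : A.B x y) (h1 : A.B y z) : A.B x z :=
  ⟨h.1.trans h1.1, fun p hp => h1.2 p (h.2 p hp)⟩

theorem B_irrefl : ¬ A.B x x := fun h => lt_irrefl _ h.1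

theorem B_chain (h : A.B x z) (h1 : A.B y z) (h2 : x < y) : A.B x y :=
  ⟨h2, fun p hp => L_int (h.2 p hp) (hp.1.trans h2) h1.1.le⟩

theorem B_iff : A.B x y ↔ ∃ d, A.D d x y := by
  constructor
  · intro h
    by_cases h1 : A.L x y
    · exact ⟨true, h, by simp [h1]⟩
    · exact ⟨false, h, by simp [h1]⟩
  · rintro ⟨d, h⟩; exact h.1

theorem D_uniq (h : A.D d x y) (h1 : A.D e x y) : d = e := by
  have := h.2.trans h1.2.symm
  cases d <;> cases e <;> simp_all

theorem L_iff : A.L x y ↔ A.D true x y := by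
  constructor
  · intro h; exact ⟨L_B h, by simp [h]⟩
  · intro h; exact h.2.1 rfl

theorem C1 (h : A.D d x y) (h1 : A.B y z) : A.D d x z := by
  refine ⟨B_trans h.1 h1, h.2.trans ⟨fun h2 => h1.2 _ h2, fun h2 => L_int h2 h.1.1 h1.1.le⟩⟩

theorem L_root (h : 0 < y) : A.L 0 y := ⟨h, fun v _ _ u hu => absurd hu (by simp)⟩

theorem C2 (hy : A.D d p y) (hz : A.D d p z) :
    ∃ x, A.D d p x ∧ (x = y ∨ A.B x y) ∧ (x = z ∨ A.B x z) := by
  cases d with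
  | true =>
    have hy := L_iff.2 hy
    have hz := L_iff.2 hz
    have hpy : p.val < y.val := hy.1
    have hpz : p.val < z.val := hz.1
    let x : A.Dom := ⟨p.val + 1, by have := y.2; omega⟩
    have hx : ∀ w, A.L p w → x = w ∨ A.B x w := by
      intro w hw
      have hpw : p.val < w.val := hw.1
      by_cases e : x = w
      · exact .inl e
      · right
        have : x.val ≠ w.val := fun h => e (Fin.ext h)
        refine ⟨show x.val < w.val by simp only [x] at *; omega, fun q hq => ?_⟩
        have hqx : q.val < p.val + 1 := hq.1
        rcases Nat.lt_succ_iff_lt_or_eq.1 hqx with h | h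
        · exact L_trans (L_int hq h (show p.val ≤ p.val + 1 by omega)) hw
        · have : q = p := Fin.ext h
          rw [this]; exact hw
    exact ⟨x, L_iff.1 (L_int hy (show p.val < p.val + 1 by omega) (show p.val + 1 ≤ y.val from hpy)),
      hx y hy, hx z hz⟩
  | false =>
    have hyn : ¬ A.L p y := fun h => by simpa using hy.2.2 h
    have hzn : ¬ A.L p z := fun h => by simpa using hz.2.2 h
    obtain ⟨x, hx, hmin⟩ := WellFounded.has_min (wellFounded_lt (α := A.Dom))
      {x | p < x ∧ ¬ A.L p x} ⟨y, hy.1.1, hyn⟩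
    have hmin : ∀ w, p < w → ¬ A.L p w → x ≤ w := fun w h1 h2 => not_lt.1 (hmin w ⟨h1, h2⟩)
    have hB : ∀ w, A.B p w → ¬ A.L p w → x = w ∨ A.B x w := by
      intro w hw hwn
      rcases (hmin w hw.1 hwn).eq_or_lt with h | h
      · exact .inl h
      · refine .inr ⟨h, fun q hq => ?_⟩
        rcases lt_trichotomy q p with h1 | h1 | h1
        · exact hw.2 q (L_int hq h1 hx.1.le)
        · subst h1; exact absurd hq hx.2
        · exfalso
          have : A.L p q := by
            by_contra hn
            exact absurd (hmin q h1 hn) (not_le.2 hq.1)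
          exact hx.2 (L_trans this hq)
    refine ⟨x, ⟨⟨hx.1, fun q hq => ?_⟩, by simp [hx.2]⟩, hB y hy.1 hyn, hB z hz.1 hzn⟩
    exact L_int (hy.1.2 q hq) (hq.1.trans hx.1) (hmin y hy.1.1 hyn)

theorem lt_iff : x < y ↔ A.B x y ∨ ∃ p, A.D true p x ∧ A.D false p y := by
  constructor
  · intro h
    by_cases hB : A.B x y
    · exact .inl hB
    · right
      have : ∃ p, A.L p x ∧ ¬ A.L p y := by
        by_contra hn
        push Not at hn
        exact hB ⟨h, hn⟩
      obtain ⟨p, hp, hmin⟩ := WellFounded.has_min (wellFounded_lt (α := A.Dom))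
        {p | A.L p x ∧ ¬ A.L p y} this
      refine ⟨p, L_iff.1 hp.1, ⟨hp.1.1.trans h, fun q hq => ?_⟩, by simp [hp.2]⟩
      by_contra hn
      exact hmin q ⟨L_trans hq hp.1, hn⟩ hq.1
  · rintro (h | ⟨p, h1, h2⟩)
    · exact h.1
    · by_contra hn
      have := h2.2.2 (L_int (L_iff.2 h1) h2.1.1 (not_lt.1 hn))
      simp at this

theorem ch_iff : A.ch x y ↔
    (A.L x y ∧ (¬ ∃ v, A.L x v ∧ A.L v y) ∧ ∃ v, x < v ∧ v < y) ∨
    (A.Mk x ∧ x < y ∧ ¬ A.L x y ∧ ¬ ∃ v, x < v ∧ v < y ∧ ¬ A.L x v) := by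
  have first : ∀ j, A.ch x j → ∀ v, x < v → v < j → A.L x v := by
    intro j hj v h1 h2
    refine ⟨h1, fun w h3 h4 u h5 h6 => ?_⟩
    exact A.nc u w x j h6 hj h5 h3 (lt_of_le_of_lt h4 h2)
  constructor
  · intro h
    have hl := A.len _ _ h
    have hxy : x < y := show x.val < y.val by omega
    by_cases hL : A.L x y
    · left
      refine ⟨hL, ?_, ⟨⟨x.val + 1, by have := y.2; omega⟩, show x.val < x.val + 1 by omega,
        show x.val + 1 < y.val by omega⟩⟩
      rintro ⟨v, h1, h2⟩
      exact h2.2 y h2.1 le_rfl x h1.1 h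
    · right
      refine ⟨⟨y, h, hL⟩, hxy, hL, ?_⟩
      rintro ⟨v, h1, h2, h3⟩
      exact h3 (first y h v h1 h2)
  · rintro (⟨h1, h2, v, h3, h4⟩ | ⟨⟨j, h1, h2⟩, h3, h4, h5⟩)
    · have h3' : x.val < v.val := h3
      have h4' : v.val < y.val := h4
      let w : A.Dom := ⟨y.val - 1, by have := y.2; omega⟩
      have hxw : x < w := show x.val < y.val - 1 by omega
      have hwy : w < y := show y.val - 1 < y.val by omega
      have hxw' : A.L x w := L_int h1 hxw hwy.le
      have : ∃ u, A.ch u y := by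
        by_contra hn
        push Not at hn
        refine h2 ⟨w, hxw', hwy, fun t ht1 ht2 u _ => ?_⟩
        have ht1' : y.val - 1 < t.val := ht1
        have ht2' : t.val ≤ y.val := ht2
        have : t = y := Fin.ext (by omega)
        rw [this]; exact hn u
      obtain ⟨u, hu, hmin⟩ := WellFounded.has_min (wellFounded_lt (α := A.Dom))
        {u | A.ch u y} this
      have huy : u < y := show u.val < y.val by have := A.len _ _ hu; omega
      rcases lt_trichotomy u x with h | h | h
      · exact absurd hu (h1.2 y h1.1 le_rfl u h)
      · rw [← h]; exact hu
      · exfalso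
        refine h2 ⟨u, L_int h1 h huy.le, huy, fun t ht1 ht2 q hq hqt => ?_⟩
        rcases ht2.eq_or_lt with e | e
        · subst e; exact hmin q hqt hq
        · exact A.nc q t u y hqt hu hq ht1 e
    · have hxj : x < j := show x.val < j.val by have := A.len _ _ h1; omega
      rcases lt_trichotomy j y with h | h | h
      · exact absurd ⟨j, hxj, h, h2⟩ h5
      · rw [← h]; exact h1
      · exact absurd (first j h1 y h3 h) h4

end NC

end

section

namespace FOV
variable {R U V D : Type}

def uns : FOV R U V → Set U
  | .fal => ∅
  | .rel _ _ _ => ∅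
  | .un u _ => {u}
  | .eqv _ _ => ∅
  | .imp f g => f.uns ∪ g.uns
  | .all _ f => f.uns

def nt (f : FOV R U V) : FOV R U V := .imp f .fal
def andd (f g : FOV R U V) : FOV R U V := nt (.imp f (nt g))
def ex (x : V) (f : FOV R U V) : FOV R U V := nt (.all x (nt f))

variable [DecidableEq V] {relI : R → D → D → Prop} {unI : U → D → Prop} {v : V → D}

@[simp] theorem realize_fal : Realize relI unI (.fal : FOV R U V) v ↔ False := Iff.rfl
@[simp] theorem realize_rel {r : R} {x y : V} :
    Realize relI unI (.rel r x y) v ↔ relI r (v x) (v y) := Iff.rfl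
@[simp] theorem realize_un {u : U} {x : V} :
    Realize relI unI (.un u x) v ↔ unI u (v x) := Iff.rfl
@[simp] theorem realize_eqv {x y : V} :
    Realize relI unI (.eqv x y) v ↔ v x = v y := Iff.rfl
@[simp] theorem realize_imp {f g : FOV R U V} :
    Realize relI unI (.imp f g) v ↔ (Realize relI unI f v → Realize relI unI g v) := Iff.rfl
@[simp] theorem realize_all {f : FOV R U V} {x : V} :
    Realize relI unI (.all x f) v ↔ ∀ d, Realize relI unI f (Function.update v x d) := Iff.rfl
@[simp] theorem realize_nt {f : FOV R U V} :
    Realize relI unI (nt f) v ↔ ¬ Realize relI unI f v := Iff.rfl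
@[simp] theorem realize_andd {f g : FOV R U V} :
    Realize relI unI (andd f g) v ↔ (Realize relI unI f v ∧ Realize relI unI g v) := by
  simp [andd]
@[simp] theorem realize_ex {f : FOV R U V} {x : V} :
    Realize relI unI (ex x f) v ↔ ∃ d, Realize relI unI f (Function.update v x d) := by
  simp [ex]

end FOV

open FOV

namespace NC
variable {AP : Type}

def relI (A : NC AP) : OPRel → A.Dom → A.Dom → Prop
  | .ord => fun a b => a < b
  | .chain => fun a b => A.ch a b

abbrev Rz (A : NC AP) {V : Type} [DecidableEq V] (f : FOV OPRel AP V) (v : V → A.Dom) : Prop :=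
  f.Realize A.relI A.P v

@[simp] theorem relI_ord {A : NC AP} {a b : A.Dom} : A.relI .ord a b ↔ a < b := Iff.rfl
@[simp] theorem relI_chain {A : NC AP} {a b : A.Dom} : A.relI .chain a b ↔ A.ch a b := Iff.rfl

def Lf (i j k : Fin 3) : FOV OPRel AP (Fin 3) :=
  andd (.rel .ord i j) (.all k (.imp (.rel .ord i k) (.imp (nt (.rel .ord j k))
    (.all j (.imp (.rel .ord j i) (nt (.rel .chain j k)))))))

theorem rz_Lf {A : NC AP} {i j k : Fin 3} (h1 : i ≠ j) (h2 : i ≠ k) (h3 : j ≠ k)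
    (v : Fin 3 → A.Dom) : A.Rz (Lf i j k) v ↔ A.L (v i) (v j) := by
  simp [Rz, Lf, NC.L, h1, h2, h3, h3.symm, h1.symm, h2.symm]

def Bf : FOV OPRel AP (Fin 3) :=
  andd (.rel .ord 0 1) (.all 2 (.imp (Lf 2 0 1) (Lf 2 1 0)))

theorem rz_Bf {A : NC AP} (v : Fin 3 → A.Dom) : A.Rz Bf v ↔ A.B (v 0) (v 1) := by
  have h1 := fun v => rz_Lf (A := A) (i := 2) (j := 0) (k := 1) (by decide) (by decide) (by decide) v
  have h2 := fun v => rz_Lf (A := A) (i := 2) (j := 1) (k := 0) (by decide) (by decide) (by decide) v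
  simp only [Rz] at h1 h2
  simp [Rz, Bf, NC.B, h1, h2]

def Mf : FOV OPRel AP (Fin 3) := ex 1 (andd (.rel .chain 0 1) (nt (Lf 0 1 2)))

theorem rz_Mf {A : NC AP} (v : Fin 3 → A.Dom) : A.Rz Mf v ↔ A.Mk (v 0) := by
  have h1 := fun v => rz_Lf (A := A) (i := 0) (j := 1) (k := 2) (by decide) (by decide) (by decide) v
  simp only [Rz] at h1
  simp [Rz, Mf, NC.Mk, h1]

/-- Back-and-forth equivalence for three pebbles. -/
def E (Us : Set AP) (A B : NC AP) : ℕ → (Fin 3 → A.Dom) → (Fin 3 → B.Dom) → Prop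
  | 0, v, v' => (∀ i j, v i = v j ↔ v' i = v' j) ∧ (∀ i j, v i < v j ↔ v' i < v' j) ∧
      (∀ i j, A.ch (v i) (v j) ↔ B.ch (v' i) (v' j)) ∧
      (∀ i, ∀ u ∈ Us, A.P u (v i) ↔ B.P u (v' i))
  | r + 1, v, v' => E Us A B r v v' ∧ ∀ i,
      (∀ d, ∃ d', E Us A B r (Function.update v i d) (Function.update v' i d')) ∧
      (∀ d', ∃ d, E Us A B r (Function.update v i d) (Function.update v' i d'))

variable {Us : Set AP} {A B : NC AP} {r : ℕ} {v : Fin 3 → A.Dom} {v' : Fin 3 → B.Dom}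

theorem E.symm (h : E Us A B r v v') : E Us B A r v' v := by
  induction r generalizing v v' with
  | zero =>
    obtain ⟨h1, h2, h3, h4⟩ := h
    exact ⟨fun i j => (h1 i j).symm, fun i j => (h2 i j).symm, fun i j => (h3 i j).symm,
      fun i u hu => (h4 i u hu).symm⟩
  | succ r ih =>
    refine ⟨ih h.1, fun i => ⟨fun d => ?_, fun d => ?_⟩⟩
    · obtain ⟨d', h'⟩ := (h.2 i).2 d
      exact ⟨d', ih h'⟩
    · obtain ⟨d', h'⟩ := (h.2 i).1 d
      exact ⟨d', ih h'⟩

theorem E.mono {s : ℕ} (h : E Us A B r v v') (hs : s ≤ r) : E Us A B s v v' := by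
  induction r with
  | zero => obtain rfl : s = 0 := by omega
            exact h
  | succ r ih =>
    rcases hs.eq_or_lt with e | e
    · rw [e]; exact h
    · exact ih h.1 (by omega)

theorem E.rz (h : E Us A B r v v') (f : FOV OPRel AP (Fin 3)) (hf : f.qr ≤ r) (hu : f.uns ⊆ Us) :
    A.Rz f v ↔ B.Rz f v' := by
  induction f generalizing r v v' with
  | fal => simp [Rz]
  | rel s x y =>
    have h0 := h.mono (Nat.zero_le r)
    cases s with
    | ord => exact h0.2.1 x y
    | chain => exact h0.2.2.1 x y
  | un u x => exact (h.mono (Nat.zero_le r)).2.2.2 x u (hu (by simp [uns]))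
  | eqv x y => exact (h.mono (Nat.zero_le r)).1 x y
  | imp f g ihf ihg =>
    simp only [qr, uns, Set.union_subset_iff, max_le_iff] at hf hu
    have h1 := ihf h hf.1 hu.1
    have h2 := ihg h hf.2 hu.2
    simp only [Rz, realize_imp] at *
    rw [h1, h2]
  | all x f ih =>
    simp only [qr, uns] at hf hu
    obtain ⟨r, rfl⟩ : ∃ s, r = s + 1 := ⟨r - 1, by omega⟩
    simp only [Rz, realize_all] at *
    constructor
    · intro H d'
      obtain ⟨d, hd⟩ := (h.2 x).2 d'
      exact (ih hd (by omega) hu).1 (H d)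
    · intro H d
      obtain ⟨d', hd⟩ := (h.2 x).1 d
      exact (ih hd (by omega) hu).2 (H d')

theorem E.copy (h : E Us A B (r + 1) v v') (i j : Fin 3) :
    E Us A B r (Function.update v i (v j)) (Function.update v' i (v' j)) := by
  by_cases hij : i = j
  · subst hij; simpa using h.1
  obtain ⟨d', hd⟩ := (h.2 i).1 (v j)
  have := (hd.mono (Nat.zero_le r)).1 i j
  simp [Ne.symm hij] at this
  rwa [this] at hd

def E2 (Us : Set AP) (A B : NC AP) (r : ℕ) (x y : A.Dom) (x' y' : B.Dom) : Prop :=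
  E Us A B r ![x, y, y] ![x', y', y']

variable {x y : A.Dom} {x' y' : B.Dom}

theorem E2.symm (h : E2 Us A B r x y x' y') : E2 Us B A r x' y' x y := E.symm h
theorem E2.mono {s : ℕ} (h : E2 Us A B r x y x' y') (hs : s ≤ r) : E2 Us A B s x y x' y' :=
  E.mono h hs

theorem E2.right (h : E2 Us A B (r + 1) x y x' y') : E2 Us A B r y y y' y' := by
  have := E.copy h 0 1
  have e1 : Function.update ![x, y, y] 0 (![x, y, y] 1) = ![y, y, y] := by
    ext i; fin_cases i <;> simp
  have e2 : Function.update ![x', y', y'] 0 (![x', y', y'] 1) = ![y', y', y'] := by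
    ext i; fin_cases i <;> simp
  rw [e1, e2] at this
  exact this

theorem E2.ext (h : E2 Us A B (r + 3) x y x' y') (z : A.Dom) :
    ∃ z', E2 Us A B r x z x' z' ∧ E2 Us A B r z y z' y' := by
  obtain ⟨z', hz⟩ := (h.2 2).1 z
  have up2 : ∀ {C : NC AP} (a b c d : C.Dom), Function.update ![a, b, c] 2 d = ![a, b, d] := by
    intro C a b c d; ext i; fin_cases i <;> simp
  have up1 : ∀ {C : NC AP} (a b c d : C.Dom), Function.update ![a, b, c] 1 d = ![a, d, c] := by
    intro C a b c d; ext i; fin_cases i <;> simp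
  have up0 : ∀ {C : NC AP} (a b c d : C.Dom), Function.update ![a, b, c] 0 d = ![d, b, c] := by
    intro C a b c d; ext i; fin_cases i <;> simp
  rw [up2, up2] at hz
  refine ⟨z', ?_, ?_⟩
  · have := hz.copy 1 2
    rw [up1, up1] at this
    exact E.mono this (by omega)
  · have := (hz.copy 0 2)
    rw [up0, up0] at this
    have := this.copy 2 1
    rw [up2, up2] at this
    exact this

theorem E2.L_iff (h : E2 Us A B r x y x' y') (hr : 3 ≤ r) : A.L x y ↔ B.L x' y' := by
  have := E.rz h (Lf 0 1 2) (by simp [Lf, qr, nt, andd]; omega) (by simp [Lf, uns, nt, andd])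
  rw [rz_Lf (by decide) (by decide) (by decide), rz_Lf (by decide) (by decide) (by decide)] at this
  simpa using this

theorem E2.B_iff (h : E2 Us A B r x y x' y') (hr : 3 ≤ r) : A.B x y ↔ B.B x' y' := by
  have := E.rz h Bf (by simp [Bf, Lf, qr, nt, andd]; omega) (by simp [Bf, Lf, uns, nt, andd])
  rw [rz_Bf, rz_Bf] at this
  simpa using this

theorem E2.M_iff (h : E2 Us A B r x y x' y') (hr : 3 ≤ r) : A.Mk x ↔ B.Mk x' := by
  have := E.rz h Mf (by simp [Mf, Lf, qr, nt, andd, FOV.ex]; omega)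
    (by simp [Mf, Lf, uns, nt, andd, FOV.ex])
  rw [rz_Mf, rz_Mf] at this
  simpa using this

theorem E2.D_iff (h : E2 Us A B r x y x' y') (hr : 3 ≤ r) (d : Bool) :
    A.D d x y ↔ B.D d x' y' := by
  simp only [NC.D, h.L_iff hr, h.B_iff hr]

/-- Game positions for full first-order logic. -/
structure St (Us : Set AP) (A B : NC AP) (r : ℕ) (T : Set (A.Dom × B.Dom)) : Prop where
  pres : ∀ a ∈ T, ∀ b ∈ T, ∀ d, A.D d a.1 b.1 ↔ B.D d a.2 b.2
  inj : ∀ a ∈ T, ∀ b ∈ T, a.1 = b.1 ↔ a.2 = b.2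
  root : (0, 0) ∈ T
  un : ∀ a ∈ T, E2 Us A B r a.1 a.1 a.2 a.2
  br : ∀ a ∈ T, ∀ d, (∃ b ∈ T, A.D d a.1 b.1) → ∃ s ∈ T, A.D d a.1 s.1 ∧
    (∀ b ∈ T, A.D d a.1 b.1 → b.1 = s.1 ∨ A.B s.1 b.1) ∧ E2 Us A B r a.1 s.1 a.2 s.2

variable {T : Set (A.Dom × B.Dom)}

theorem St.presB (h : St Us A B r T) {a b : A.Dom × B.Dom} (ha : a ∈ T) (hb : b ∈ T) :
    A.B a.1 b.1 ↔ B.B a.2 b.2 := by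
  simp only [NC.B_iff, h.pres a ha b hb]

theorem St.presL (h : St Us A B r T) {a b : A.Dom × B.Dom} (ha : a ∈ T) (hb : b ∈ T) :
    A.L a.1 b.1 ↔ B.L a.2 b.2 := by
  simp only [NC.L_iff, h.pres a ha b hb]

theorem St.mono {s : ℕ} (h : St Us A B r T) (hs : s ≤ r) : St Us A B s T where
  pres := h.pres
  inj := h.inj
  root := h.root
  un a ha := (h.un a ha).mono hs
  br a ha d hb := by
    obtain ⟨s, h1, h2, h3, h4⟩ := h.br a ha d hb
    exact ⟨s, h1, h2, h3, h4.mono hs⟩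

theorem St.swap (h : St Us A B r T) : St Us B A r (Prod.swap ⁻¹' T) where
  pres a ha b hb d := (h.pres _ ha _ hb d).symm
  inj a ha b hb := (h.inj _ ha _ hb).symm
  root := h.root
  un a ha := (h.un _ ha).symm
  br a ha d := by
    rintro ⟨b, hb, hd⟩
    obtain ⟨s, h1, h2, h3, h4⟩ := h.br _ ha d ⟨b.swap, hb, (h.pres _ ha _ hb d).2 hd⟩
    refine ⟨s.swap, by simpa using h1, (h.pres _ ha _ h1 d).1 h2, fun c hc hdc => ?_, h4.symm⟩
    have hc' : c.swap ∈ T := hc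
    rcases h3 c.swap hc' ((h.pres _ ha _ hc' d).2 hdc) with e | e
    · exact .inl ((h.inj _ hc' _ h1).1 e)
    · exact .inr ((h.presB h1 hc').1 e)

/-- relations below a new point hanging directly over `p` -/
theorem below {C : NC AP} {S : Set C.Dom} {p z : C.Dom} {d : Bool} (hz : C.D d p z)
    (hS : ∀ s ∈ S, C.D d p s → ¬ C.B s z) {s : C.Dom} (hs : s ∈ S) (e : Bool) :
    C.D e s z ↔ (s = p ∧ e = d) ∨ C.D e s p := by
  constructor
  · intro h
    rcases lt_trichotomy s p with h1 | h1 | h1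
    · obtain ⟨e', he'⟩ := NC.B_iff.1 (NC.B_chain h.1 hz.1 h1)
      have := NC.D_uniq h (NC.C1 he' hz.1)
      subst this; exact .inr he'
    · subst h1; exact .inl ⟨rfl, NC.D_uniq h hz⟩
    · obtain ⟨e', he'⟩ := NC.B_iff.1 (NC.B_chain hz.1 h.1 h1)
      have := NC.D_uniq hz (NC.C1 he' h.1)
      subst this
      exact absurd h.1 (hS s hs he')
  · rintro (⟨rfl, rfl⟩ | h)
    · exact hz
    · exact NC.C1 h hz.1

theorem above {C : NC AP} {S : Set C.Dom} {p s₀ m : C.Dom} {d : Bool} (hm : C.D d p m)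
    (hms : C.B m s₀) (hS : ∀ s ∈ S, C.D d p s → s = s₀ ∨ C.B s₀ s)
    {s : C.Dom} (hs : s ∈ S) (e : Bool) :
    C.D e m s ↔ (s = s₀ ∨ C.B s₀ s) ∧ C.D e m s₀ := by
  constructor
  · intro h
    have h1 := hS s hs (NC.C1 hm h.1)
    refine ⟨h1, ?_⟩
    rcases h1 with rfl | h1
    · exact h
    · obtain ⟨e', he'⟩ := NC.B_iff.1 hms
      have := NC.D_uniq h (NC.C1 he' h1)
      subst this; exact he'
  · rintro ⟨rfl | h1, h2⟩
    · exact h2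
    · exact NC.C1 h2 h1

theorem St.insert {c : A.Dom × B.Dom} (h : St Us A B r T) (hc : E2 Us A B r c.1 c.1 c.2 c.2)
    (h1 : ∀ a ∈ T, ∀ d, A.D d a.1 c.1 ↔ B.D d a.2 c.2)
    (h2 : ∀ a ∈ T, ∀ d, A.D d c.1 a.1 ↔ B.D d c.2 a.2)
    (h3 : ∀ a ∈ T, a.1 ≠ c.1 ∧ a.2 ≠ c.2)
    (h4 : ∀ a ∈ Insert.insert c T, ∀ d, (∃ b ∈ Insert.insert c T, A.D d a.1 b.1) →
      ∃ s ∈ Insert.insert c T, A.D d a.1 s.1 ∧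
    (∀ b ∈ Insert.insert c T, A.D d a.1 b.1 → b.1 = s.1 ∨ A.B s.1 b.1) ∧
      E2 Us A B r a.1 s.1 a.2 s.2) :
    St Us A B r (Insert.insert c T) where
  pres := by
    rintro a (rfl | ha) b (rfl | hb) d
    · exact ⟨fun h => absurd h.1 NC.B_irrefl, fun h => absurd h.1 NC.B_irrefl⟩
    · exact h2 b hb d
    · exact h1 a ha d
    · exact h.pres a ha b hb d
  inj := by
    rintro a (rfl | ha) b (rfl | hb)
    · simp
    · exact ⟨fun e => absurd e.symm (h3 b hb).1, fun e => absurd e.symm (h3 b hb).2⟩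
    · exact ⟨fun e => absurd e (h3 a ha).1, fun e => absurd e (h3 a ha).2⟩
    · exact h.inj a ha b hb
  root := .inr h.root
  un := by
    rintro a (rfl | ha)
    · exact hc
    · exact h.un a ha
  br := h4

theorem St.moveA (h : St Us A B (r + 4) T) (hr : 3 ≤ r) {p : A.Dom × B.Dom} (hp : p ∈ T)
    {z : A.Dom} {d : Bool} (hz : A.D d p.1 z) (hn : ∀ b ∈ T, ¬ A.D d p.1 b.1) :
    ∃ z', St Us A B r (Insert.insert (z, z') T) := by
  have hun := h.un p hp
  obtain ⟨z', hz1, -⟩ := E2.ext (r := r + 1) hun z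
  refine ⟨z', ?_⟩
  have hz' : B.D d p.2 z' := (hz1.D_iff (by omega) d).1 hz
  have hn' : ∀ b ∈ T, ¬ B.D d p.2 b.2 := fun b hb hd => hn b hb ((h.pres p hp b hb d).2 hd)
  have bA : ∀ a ∈ T, ∀ e, A.D e a.1 z ↔ (a.1 = p.1 ∧ e = d) ∨ A.D e a.1 p.1 := by
    intro a ha e
    refine below (S := Prod.fst '' T) hz ?_ ⟨a, ha, rfl⟩ e
    rintro _ ⟨b, hb, rfl⟩ hd
    exact absurd hd (hn b hb)
  have bB : ∀ a ∈ T, ∀ e, B.D e a.2 z' ↔ (a.2 = p.2 ∧ e = d) ∨ B.D e a.2 p.2 := by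
    intro a ha e
    refine below (S := Prod.snd '' T) hz' ?_ ⟨a, ha, rfl⟩ e
    rintro _ ⟨b, hb, rfl⟩ hd
    exact absurd hd (hn' b hb)
  have nA : ∀ a ∈ T, ∀ e, ¬ A.D e z a.1 := fun a ha e hd => hn a ha (NC.C1 hz hd.1)
  have nB : ∀ a ∈ T, ∀ e, ¬ B.D e z' a.2 := fun a ha e hd => hn' a ha (NC.C1 hz' hd.1)
  refine (h.mono (by omega)).insert (hz1.right) ?_ ?_ ?_ ?_
  · intro a ha e
    rw [bA a ha e, bB a ha e, h.inj a ha p hp, h.pres a ha p hp]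
  · intro a ha e
    exact ⟨fun hd => absurd hd (nA a ha e), fun hd => absurd hd (nB a ha e)⟩
  · intro a ha
    refine ⟨?_, ?_⟩
    · intro e; exact hn a ha (e ▸ hz)
    · intro e; exact hn' a ha (e ▸ hz')
  · rintro a (rfl | ha) e ⟨b, hb, hab⟩
    · rcases hb with rfl | hb
      · exact absurd hab.1 NC.B_irrefl
      · exact absurd hab (nA b hb e)
    · by_cases hap : a.1 = p.1 ∧ e = d
      · obtain ⟨h1, rfl⟩ := hap
        have h2 := (h.inj a ha p hp).1 h1
        have : a = p := Prod.ext h1 h2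
        subst this
        refine ⟨(z, z'), .inl rfl, hz, ?_, hz1.mono (by omega)⟩
        rintro b (rfl | hb) hab
        · exact .inl rfl
        · exact absurd hab (hn b hb)
      · have hex : ∃ b ∈ T, A.D e a.1 b.1 := by
          rcases hb with rfl | hb
          · rcases (bA a ha e).1 hab with h1 | h1
            · exact absurd h1 hap
            · exact ⟨p, hp, h1⟩
          · exact ⟨b, hb, hab⟩
        obtain ⟨s, hs, h1, h2, h3⟩ := h.br a ha e hex
        refine ⟨s, .inr hs, h1, ?_, h3.mono (by omega)⟩
        rintro b (rfl | hb) hab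
        · rcases (bA a ha e).1 hab with h4 | h4
          · exact absurd h4 hap
          · rcases h2 p hp h4 with h5 | h5
            · exact .inr (h5 ▸ hz.1)
            · exact .inr (NC.B_trans h5 hz.1)
        · exact h2 b hb hab

theorem St.moveB (h : St Us A B (r + 4) T) (hr : 3 ≤ r) {p s : A.Dom × B.Dom} (hp : p ∈ T)
    (hs : s ∈ T) {m : A.Dom} {d : Bool} (hm : A.D d p.1 m) (hms : A.B m s.1)
    (hmin : ∀ b ∈ T, A.D d p.1 b.1 → b.1 = s.1 ∨ A.B s.1 b.1)
    (hE : E2 Us A B (r + 4) p.1 s.1 p.2 s.2) :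
    ∃ m', St Us A B r (Insert.insert (m, m') T) := by
  obtain ⟨m', hz1, hz2⟩ := E2.ext (r := r + 1) hE m
  refine ⟨m', ?_⟩
  have hm' : B.D d p.2 m' := (hz1.D_iff (by omega) d).1 hm
  have hms' : B.B m' s.2 := (hz2.B_iff (by omega)).1 hms
  have hmin' : ∀ b ∈ T, B.D d p.2 b.2 → b.2 = s.2 ∨ B.B s.2 b.2 := by
    intro b hb hd
    rcases hmin b hb ((h.pres p hp b hb d).2 hd) with h1 | h1
    · exact .inl ((h.inj b hb s hs).1 h1)
    · exact .inr ((h.presB hs hb).1 h1)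
  have bA : ∀ a ∈ T, ∀ e, A.D e a.1 m ↔ (a.1 = p.1 ∧ e = d) ∨ A.D e a.1 p.1 := by
    intro a ha e
    refine below (S := Prod.fst '' T) hm ?_ ⟨a, ha, rfl⟩ e
    rintro _ ⟨b, hb, rfl⟩ hd hbm
    have h2 := NC.B_trans hbm hms
    rcases hmin b hb hd with h1 | h1
    · rw [h1] at h2; exact NC.B_irrefl h2
    · exact NC.B_irrefl (NC.B_trans h1 h2)
  have bB : ∀ a ∈ T, ∀ e, B.D e a.2 m' ↔ (a.2 = p.2 ∧ e = d) ∨ B.D e a.2 p.2 := by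
    intro a ha e
    refine below (S := Prod.snd '' T) hm' ?_ ⟨a, ha, rfl⟩ e
    rintro _ ⟨b, hb, rfl⟩ hd hbm
    have h2 := NC.B_trans hbm hms'
    rcases hmin' b hb hd with h1 | h1
    · rw [h1] at h2; exact NC.B_irrefl h2
    · exact NC.B_irrefl (NC.B_trans h1 h2)
  have aA : ∀ a ∈ T, ∀ e, A.D e m a.1 ↔ (a.1 = s.1 ∨ A.B s.1 a.1) ∧ A.D e m s.1 := by
    intro a ha e
    refine above (S := Prod.fst '' T) hm hms ?_ ⟨a, ha, rfl⟩ e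
    rintro _ ⟨b, hb, rfl⟩ hd
    exact hmin b hb hd
  have aB : ∀ a ∈ T, ∀ e, B.D e m' a.2 ↔ (a.2 = s.2 ∨ B.B s.2 a.2) ∧ B.D e m' s.2 := by
    intro a ha e
    refine above (S := Prod.snd '' T) hm' hms' ?_ ⟨a, ha, rfl⟩ e
    rintro _ ⟨b, hb, rfl⟩ hd
    exact hmin' b hb hd
  refine (h.mono (by omega)).insert (hz1.right) ?_ ?_ ?_ ?_
  · intro a ha e
    rw [bA a ha e, bB a ha e, h.inj a ha p hp, h.pres a ha p hp]
  · intro a ha e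
    rw [aA a ha e, aB a ha e, h.inj a ha s hs, h.presB hs ha, hz2.D_iff (by omega)]
  · intro a ha
    refine ⟨?_, ?_⟩
    · intro e
      dsimp at e
      rcases hmin a ha (e ▸ hm) with h1 | h1
      · rw [← e, h1] at hms; exact NC.B_irrefl hms
      · rw [e] at h1; exact NC.B_irrefl (NC.B_trans h1 hms)
    · intro e
      dsimp at e
      rcases hmin' a ha (e ▸ hm') with h1 | h1
      · rw [← e, h1] at hms'; exact NC.B_irrefl hms'
      · rw [e] at h1; exact NC.B_irrefl (NC.B_trans h1 hms')
  · rintro a (rfl | ha) e ⟨b, hb, hab⟩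
    · rcases hb with rfl | hb
      · exact absurd hab.1 NC.B_irrefl
      · refine ⟨s, .inr hs, ((aA b hb e).1 hab).2, ?_, hz2.mono (by omega)⟩
        rintro b (rfl | hb) hab
        · exact absurd hab.1 NC.B_irrefl
        · exact ((aA b hb e).1 hab).1
    · by_cases hap : a.1 = p.1 ∧ e = d
      · obtain ⟨h1, rfl⟩ := hap
        have h2 := (h.inj a ha p hp).1 h1
        have : a = p := Prod.ext h1 h2
        subst this
        refine ⟨(m, m'), .inl rfl, hm, ?_, hz1.mono (by omega)⟩
        rintro b (rfl | hb) hab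
        · exact .inl rfl
        · right
          rcases hmin b hb hab with h3 | h3
          · rw [h3]; exact hms
          · exact NC.B_trans hms h3
      · have hex : ∃ b ∈ T, A.D e a.1 b.1 := by
          rcases hb with rfl | hb
          · rcases (bA a ha e).1 hab with h1 | h1
            · exact absurd h1 hap
            · exact ⟨p, hp, h1⟩
          · exact ⟨b, hb, hab⟩
        obtain ⟨s, hs, h1, h2, h3⟩ := h.br a ha e hex
        refine ⟨s, .inr hs, h1, ?_, h3.mono (by omega)⟩
        rintro b (rfl | hb) hab
        · rcases (bA a ha e).1 hab with h4 | h4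
          · exact absurd h4 hap
          · rcases h2 p hp h4 with h5 | h5
            · exact .inr (h5 ▸ hm.1)
            · exact .inr (NC.B_trans h5 hm.1)
        · exact h2 b hb hab

theorem St.step (h : St Us A B (r + 8) T) (hr : 3 ≤ r) (z : A.Dom) :
    ∃ z' T', T ⊆ T' ∧ (z, z') ∈ T' ∧ St Us A B r T' := by
  by_cases hzT : ∃ b ∈ T, b.1 = z
  · obtain ⟨⟨b, b'⟩, hb, rfl⟩ := hzT
    exact ⟨b', T, subset_rfl, hb, h.mono (by omega)⟩
  push Not at hzT
  have h0 : (0 : A.Dom) ≠ z := hzT _ h.root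
  have hB0 : A.B 0 z := NC.L_B (NC.L_root (Fin.pos_of_ne_zero h0.symm))
  -- maximal ancestor
  obtain ⟨q, ⟨⟨p, hp, rfl⟩, hpz⟩, hmax⟩ := WellFounded.has_min (wellFounded_gt (α := A.Dom))
    {q | (∃ b ∈ T, b.1 = q) ∧ A.B q z} ⟨0, ⟨_, h.root, rfl⟩, hB0⟩
  have hmax : ∀ b ∈ T, A.B b.1 z → ¬ p.1 < b.1 := fun b hb hbz => hmax b.1 ⟨⟨b, hb, rfl⟩, hbz⟩
  obtain ⟨d, hd⟩ := NC.B_iff.1 hpz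
  by_cases hex : ∃ b ∈ T, A.D d p.1 b.1
  · obtain ⟨s, hs, h1, h2, h3⟩ := h.br p hp d hex
    have hsz : s.1 ≠ z := hzT s hs
    have hsz' : ¬ A.B s.1 z := fun hb => hmax s hs hb h1.1.1
    by_cases hzs : A.B z s.1
    · obtain ⟨z', hz'⟩ := (h.mono (show r + 4 ≤ r + 8 by omega)).moveB hr hp hs hd hzs h2
        (h3.mono (by omega))
      exact ⟨z', _, Set.subset_insert _ _, .inl rfl, hz'⟩
    · obtain ⟨m, ⟨hm1, hm2, hm3⟩, hmm⟩ := WellFounded.has_min (wellFounded_gt (α := A.Dom))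
        {x | A.D d p.1 x ∧ (x = s.1 ∨ A.B x s.1) ∧ (x = z ∨ A.B x z)} (NC.C2 h1 hd)
      have hms : A.B m s.1 := by
        rcases hm2 with rfl | hm2
        · rcases hm3 with e | e
          · exact absurd e hsz
          · exact absurd e hsz'
        · exact hm2
      have hmz : A.B m z := by
        rcases hm3 with rfl | hm3
        · exact absurd hms hzs
        · exact hm3
      obtain ⟨m', hm'⟩ := h.moveB (r := r + 4) (by omega) hp hs hm1 hms h2 h3
      obtain ⟨f, hf⟩ := NC.B_iff.1 hmz
      have hf' : ¬ A.D f m s.1 := by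
        intro hms'
        obtain ⟨x, hx1, hx2, hx3⟩ := NC.C2 hms' hf
        exact hmm x ⟨NC.C1 hm1 hx1.1, hx2, hx3⟩ hx1.1.1
      obtain ⟨z', hz'⟩ := hm'.moveA hr (p := (m, m')) (.inl rfl) hf (by
        rintro b (rfl | hb) hd'
        · exact NC.B_irrefl hd'.1
        · apply hf'
          refine ((above (S := Prod.fst '' T) hm1 hms ?_ ⟨b, hb, rfl⟩ f).1 hd').2
          rintro _ ⟨b, hb, rfl⟩ hd
          exact h2 b hb hd)
      exact ⟨z', _, (Set.subset_insert _ _).trans (Set.subset_insert _ _), .inl rfl, hz'⟩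
  · push Not at hex
    obtain ⟨z', hz'⟩ := (h.mono (show r + 4 ≤ r + 8 by omega)).moveA hr hp hd hex
    exact ⟨z', _, Set.subset_insert _ _, .inl rfl, hz'⟩

end NC

end

section
open FOV
namespace NC
variable {AP : Type} {Us : Set AP} {A B : NC AP} {r : ℕ} {T : Set (A.Dom × B.Dom)}

theorem St.ex_iff (h : St Us A B (r + 8) T) (hr : 3 ≤ r) {p : A.Dom → Prop} {q : B.Dom → Prop}
    (H : ∀ T' c, T ⊆ T' → c ∈ T' → St Us A B r T' → (p c.1 ↔ q c.2)) :
    (∃ v, p v) ↔ ∃ v, q v := by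
  constructor
  · rintro ⟨z, hz⟩
    obtain ⟨z', T', h1, h2, h3⟩ := h.step hr z
    exact ⟨z', (H T' _ h1 h2 h3).1 hz⟩
  · rintro ⟨z, hz⟩
    obtain ⟨z', T', h1, h2, h3⟩ := h.swap.step hr z
    refine ⟨z', (H (Prod.swap ⁻¹' T') (z', z) ?_ h2 h3.swap).2 hz⟩
    intro c hc
    exact h1 (by simpa using hc)

theorem St.lt_iff (h : St Us A B 11 T) {a b : A.Dom × B.Dom} (ha : a ∈ T) (hb : b ∈ T) :
    a.1 < b.1 ↔ a.2 < b.2 := by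
  rw [NC.lt_iff, NC.lt_iff, h.presB ha hb]
  refine or_congr Iff.rfl (St.ex_iff (r := 3) h le_rfl ?_)
  intro T' c h1 h2 h3
  rw [h3.pres c h2 a (h1 ha), h3.pres c h2 b (h1 hb)]

theorem St.ch_iff (h : St Us A B 19 T) {a b : A.Dom × B.Dom} (ha : a ∈ T) (hb : b ∈ T) :
    A.ch a.1 b.1 ↔ B.ch a.2 b.2 := by
  rw [NC.ch_iff, NC.ch_iff, h.presL ha hb, (h.mono (by omega)).lt_iff ha hb,
    (h.un a ha).M_iff (by omega)]
  refine or_congr (and_congr Iff.rfl (and_congr (not_congr ?_) ?_))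
    (and_congr Iff.rfl (and_congr Iff.rfl (and_congr Iff.rfl (not_congr ?_))))
  · refine St.ex_iff (r := 11) h (by omega) ?_
    intro T' c h1 h2 h3
    rw [h3.presL (h1 ha) h2, h3.presL h2 (h1 hb)]
  · refine St.ex_iff (r := 11) h (by omega) ?_
    intro T' c h1 h2 h3
    rw [h3.lt_iff (h1 ha) h2, h3.lt_iff h2 (h1 hb)]
  · refine St.ex_iff (r := 11) h (by omega) ?_
    intro T' c h1 h2 h3
    rw [h3.lt_iff (h1 ha) h2, h3.lt_iff h2 (h1 hb), h3.presL (h1 ha) h2]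

theorem St.rz {V : Type} [DecidableEq V] (f : FOV OPRel AP V) (hu : f.uns ⊆ Us) :
    ∃ r, ∀ (A B : NC AP) (T : Set (A.Dom × B.Dom)) v v', St Us A B r T →
      (∀ x, (v x, v' x) ∈ T) → (A.Rz f v ↔ B.Rz f v') := by
  induction f with
  | fal => exact ⟨0, fun A B T v v' _ _ => by simp [Rz]⟩
  | rel s x y =>
    refine ⟨19, fun A B T v v' h hv => ?_⟩
    cases s with
    | ord => exact (h.mono (by omega)).lt_iff (hv x) (hv y)
    | chain => exact h.ch_iff (hv x) (hv y)
  | un u x =>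
    refine ⟨0, fun A B T v v' h hv => ?_⟩
    exact (h.un _ (hv x)).2.2.2 0 u (hu (by simp [uns]))
  | eqv x y =>
    refine ⟨0, fun A B T v v' h hv => ?_⟩
    exact h.inj _ (hv x) _ (hv y)
  | imp f g ihf ihg =>
    simp only [uns, Set.union_subset_iff] at hu
    obtain ⟨r1, h1⟩ := ihf hu.1
    obtain ⟨r2, h2⟩ := ihg hu.2
    refine ⟨max r1 r2, fun A B T v v' h hv => ?_⟩
    have h1 := h1 A B T v v' (h.mono (le_max_left _ _)) hv
    have h2 := h2 A B T v v' (h.mono (le_max_right _ _)) hv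
    simp only [Rz, realize_imp] at *
    rw [h1, h2]
  | all x f ih =>
    obtain ⟨r, hf⟩ := ih hu
    refine ⟨max r 3 + 8, fun A B T v v' h hv => ?_⟩
    have := h.ex_iff (le_max_right _ _) (p := fun d => ¬ A.Rz f (Function.update v x d))
      (q := fun d => ¬ B.Rz f (Function.update v' x d)) (by
        intro T' c h1 h2 h3
        refine not_congr (hf A B T' _ _ (h3.mono (le_max_left _ _)) ?_)
        intro y
        by_cases hy : y = x
        · subst hy; simpa using h2
        · simpa [hy] using h1 (hv y))
    simp only [Rz, realize_all] at *
    rw [← not_iff_not]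
    push Not
    exact this

theorem St.init {i : A.Dom} {i' : B.Dom} (hr : 3 ≤ r)
    (h : E Us A B (r + 4) (fun _ => i) (fun _ => i')) :
    ∃ T, (i, i') ∈ T ∧ St Us A B r T := by
  obtain ⟨d, hd⟩ := (h.2 0).1 0
  have hd0 : d = 0 := by
    have := hd.rz (.all 1 (nt (.rel .ord 1 0))) (by simp [qr, nt]) (by simp [uns, nt])
    simp only [Rz, realize_all, realize_nt, realize_rel, relI_ord] at this
    have := this.1 (by simp) 0
    simpa using this
  subst hd0
  have u1 : ∀ {C : NC AP} (a b : C.Dom), Function.update (fun _ => b) 0 a = ![a, b, b] := by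
    intro C a b; ext i; fin_cases i <;> simp
  have u2 : ∀ {C : NC AP} (a b : C.Dom),
      Function.update (Function.update ![a, b, b] 1 a) 2 a = ![a, a, a] := by
    intro C a b; ext i; fin_cases i <;> simp
  rw [u1, u1] at hd
  have h0 : E2 Us A B r 0 0 0 0 := by
    have := (E.copy hd 1 0).copy 2 0
    simp only [Matrix.cons_val_zero, ne_eq, zero_ne_one, not_false_eq_true,
      Function.update_of_ne] at this
    rw [u2, u2] at this
    exact E.mono this (by omega)
  have hi : E2 Us A B (r + 3) 0 i 0 i' := hd
  have s0 : St Us A B r {((0 : A.Dom), (0 : B.Dom))} := by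
    refine ⟨?_, ?_, rfl, ?_, ?_⟩
    · rintro _ rfl _ rfl d
      exact ⟨fun h => absurd h.1 NC.B_irrefl, fun h => absurd h.1 NC.B_irrefl⟩
    · rintro _ rfl _ rfl; simp
    · rintro _ rfl; exact h0
    · rintro _ rfl d ⟨_, rfl, h⟩
      exact absurd h.1 NC.B_irrefl
  have hz := (hi.mono (Nat.zero_le _)).1 0 1
  simp only [Matrix.cons_val_zero, Matrix.cons_val_one] at hz
  by_cases e : i = 0
  · subst e
    have : (0 : B.Dom) = i' := hz.1 rfl
    exact ⟨_, by rw [← this]; rfl, s0⟩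
  · have e' : ¬ (0 : B.Dom) = i' := fun h => e (hz.2 h).symm
    have nA : ∀ d, ¬ A.D d i 0 := fun d h => absurd h.1.1 (by simp)
    have nB : ∀ d, ¬ B.D d i' 0 := fun d h => absurd h.1.1 (by simp)
    refine ⟨_, .inl rfl, s0.insert (c := (i, i')) ?_ ?_ ?_ ?_ ?_⟩
    · exact hi.right.mono (by omega)
    · rintro _ rfl d
      exact hi.D_iff (by omega) d
    · rintro _ rfl d
      exact ⟨fun h => absurd h (nA d), fun h => absurd h (nB d)⟩
    · rintro _ rfl
      exact ⟨fun h => e h.symm, e'⟩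
    · rintro _ (rfl | rfl) d ⟨_, rfl | rfl, hb⟩
      · exact absurd hb.1 NC.B_irrefl
      · exact absurd hb (nA d)
      · refine ⟨_, .inl rfl, hb, ?_, hi.mono (by omega)⟩
        rintro _ (rfl | rfl) hc
        · exact .inl rfl
        · exact absurd hc.1 NC.B_irrefl
      · exact absurd hb.1 NC.B_irrefl

/-! Hintikka formulas -/

abbrev F3 (AP : Type) := FOV OPRel AP (Fin 3)

def Ag (F : List (F3 AP)) (A B : NC AP) (v : Fin 3 → A.Dom) (v' : Fin 3 → B.Dom) : Prop :=
  ∀ f ∈ F, A.Rz f v ↔ B.Rz f v'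

def pats : List (F3 AP) → List (F3 AP)
  | [] => [nt .fal]
  | f :: F => (pats F).flatMap fun g => [andd f g, andd (nt f) g]

theorem pats_ex (F : List (F3 AP)) (A : NC AP) (v : Fin 3 → A.Dom) :
    ∃ g ∈ pats F, A.Rz g v := by
  induction F with
  | nil => exact ⟨nt .fal, by simp [pats], by simp [Rz]⟩
  | cons f F ih =>
    obtain ⟨g, hg, h⟩ := ih
    by_cases hf : A.Rz f v
    · refine ⟨andd f g, ?_, ?_⟩
      · simp only [pats, List.mem_flatMap]; exact ⟨g, hg, by simp⟩
      · simp only [Rz, realize_andd] at *; exact ⟨hf, h⟩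
    · refine ⟨andd (nt f) g, ?_, ?_⟩
      · simp only [pats, List.mem_flatMap]; exact ⟨g, hg, by simp⟩
      · simp only [Rz, realize_andd, realize_nt] at *; exact ⟨hf, h⟩

theorem pats_ag (F : List (F3 AP)) {A B : NC AP} {v : Fin 3 → A.Dom} {v' : Fin 3 → B.Dom}
    {g : F3 AP} (hg : g ∈ pats F) (h : A.Rz g v) (h' : B.Rz g v') : Ag F A B v v' := by
  induction F generalizing g with
  | nil => intro f hf; simp at hf
  | cons f F ih =>
    simp only [pats, List.mem_flatMap] at hg
    obtain ⟨k, hk, hg⟩ := hg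
    simp only [List.mem_cons, List.not_mem_nil, or_false] at hg
    intro q hq
    rcases hg with rfl | rfl
    · simp only [Rz, realize_andd] at h h'
      rcases List.mem_cons.1 hq with rfl | hq
      · exact ⟨fun _ => h'.1, fun _ => h.1⟩
      · exact ih hk h.2 h'.2 q hq
    · simp only [Rz, realize_andd, realize_nt] at h h'
      rcases List.mem_cons.1 hq with rfl | hq
      · exact ⟨fun x => absurd x h.1, fun x => absurd x h'.1⟩
      · exact ih hk h.2 h'.2 q hq

theorem uns_fin {V : Type} (f : FOV OPRel AP V) : f.uns.Finite := by
  induction f with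
  | imp f g h1 h2 => exact h1.union h2
  | all x f h => exact h
  | un u x => exact Set.finite_singleton _
  | _ => exact Set.finite_empty

theorem hint (hU : Us.Finite) (r : ℕ) : ∃ F : List (F3 AP), ∀ (A B : NC AP) v v',
    Ag F A B v v' → E Us A B r v v' := by
  induction r with
  | zero =>
    have hfin : (Set.range (fun p : Fin 3 × Fin 3 => (FOV.eqv p.1 p.2 : F3 AP)) ∪
        Set.range (fun p : Fin 3 × Fin 3 => (FOV.rel .ord p.1 p.2 : F3 AP)) ∪
        Set.range (fun p : Fin 3 × Fin 3 => (FOV.rel .chain p.1 p.2 : F3 AP)) ∪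
        (fun p : AP × Fin 3 => (FOV.un p.1 p.2 : F3 AP)) '' (Us ×ˢ Set.univ)).Finite :=
      (((Set.finite_range _).union (Set.finite_range _)).union (Set.finite_range _)).union
        ((hU.prod Set.finite_univ).image _)
    refine ⟨hfin.toFinset.toList, fun A B v v' h => ⟨?_, ?_, ?_, ?_⟩⟩
    · intro i j
      exact h (.eqv i j) (by simp)
    · intro i j
      exact h (.rel .ord i j) (by simp)
    · intro i j
      exact h (.rel .chain i j) (by simp)
    · intro i u hu
      exact h (.un u i) (by simp [hu])
  | succ r ih =>
    obtain ⟨F, hF⟩ := ih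
    refine ⟨F ++ (List.finRange 3).flatMap fun i => (pats F).map (FOV.ex i),
      fun A B v v' h => ⟨hF _ _ _ _ fun f hf => h f (by simp [hf]), fun i => ⟨fun d => ?_,
      fun d' => ?_⟩⟩⟩
    · obtain ⟨g, hg, hr⟩ := pats_ex F A (Function.update v i d)
      have := h (ex i g) (by simp; exact .inr ⟨i, g, hg, rfl⟩)
      simp only [Rz, realize_ex] at this
      obtain ⟨d', hd'⟩ := this.1 ⟨d, hr⟩
      exact ⟨d', hF _ _ _ _ (pats_ag F hg hr hd')⟩
    · obtain ⟨g, hg, hr⟩ := pats_ex F B (Function.update v' i d')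
      have := h (ex i g) (by simp; exact .inr ⟨i, g, hg, rfl⟩)
      simp only [Rz, realize_ex] at this
      obtain ⟨d, hd⟩ := this.2 ⟨d', hr⟩
      exact ⟨d, hF _ _ _ _ (pats_ag F hg hd hr)⟩

/-- Predicates invariant under agreement on `F` are definable. -/
theorem defin (F : List (F3 AP)) (Q : (A : NC AP) → A.Dom → Prop)
    (hQ : ∀ A B i i', Ag F A B (fun _ => i) (fun _ => i') → (Q A i ↔ Q B i')) :
    ∃ ψ : F3 AP, ∀ A i, A.Rz ψ (fun _ => i) ↔ Q A i := by
  induction F generalizing Q with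
  | nil =>
    by_cases h : ∃ A i, Q A i
    · obtain ⟨B, j, h⟩ := h
      refine ⟨nt .fal, fun A i => ?_⟩
      simp only [Rz, realize_nt, realize_fal, not_false_eq_true, true_iff]
      exact (hQ B A j i (by intro f hf; simp at hf)).1 h
    · refine ⟨.fal, fun A i => ?_⟩
      simp only [Rz, realize_fal, false_iff]
      exact fun hq => h ⟨A, i, hq⟩
  | cons f F ih =>
    have key : ∀ s : Prop, ∃ ψ : F3 AP, ∀ A i, (A.Rz f (fun _ => i) ↔ s) →
        (A.Rz ψ (fun _ => i) ↔ Q A i) := by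
      intro s
      obtain ⟨ψ, hψ⟩ := ih (fun A i => ∃ B j, Ag F A B (fun _ => i) (fun _ => j) ∧
          (B.Rz f (fun _ => j) ↔ s) ∧ Q B j) (by
        intro A B i i' h
        constructor
        · rintro ⟨C, j, h1, h2⟩
          exact ⟨C, j, fun g hg => (h g hg).symm.trans (h1 g hg), h2⟩
        · rintro ⟨C, j, h1, h2⟩
          exact ⟨C, j, fun g hg => (h g hg).trans (h1 g hg), h2⟩)
      refine ⟨ψ, fun A i hs => (hψ A i).trans ⟨?_, fun hq => ⟨A, i, fun _ _ => Iff.rfl, hs, hq⟩⟩⟩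
      rintro ⟨C, j, h1, h2, h3⟩
      refine (hQ A C i j ?_).2 h3
      intro g hg
      rcases List.mem_cons.1 hg with rfl | hg
      · exact hs.trans h2.symm
      · exact h1 g hg
    obtain ⟨ψ1, h1⟩ := key True
    obtain ⟨ψ2, h2⟩ := key False
    refine ⟨andd (.imp f ψ1) (.imp (nt f) ψ2), fun A i => ?_⟩
    have h1 := h1 A i
    have h2 := h2 A i
    simp only [Rz, realize_andd, realize_imp, realize_nt] at *
    tauto

theorem main (φ : FOV OPRel AP ℕ) : ∃ ψ : F3 AP, ψ.free ⊆ {0} ∧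
    ∀ (A : NC AP) i, A.Rz φ (fun _ => i) ↔ A.Rz ψ (fun _ => i) := by
  obtain ⟨r, hr⟩ := St.rz φ (subset_refl _)
  obtain ⟨F, hF⟩ := hint (uns_fin φ) (max r 3 + 4)
  obtain ⟨ψ, hψ⟩ := defin F (fun A i => A.Rz φ (fun _ => i)) (by
    intro A B i i' h
    obtain ⟨T, hT, hS⟩ := St.init (le_max_right _ _) (hF A B _ _ h)
    exact hr A B T _ _ (hS.mono (le_max_left _ _)) fun _ => hT)
  refine ⟨.all 1 (.all 2 (.imp (.eqv 1 0) (.imp (.eqv 2 0) ψ))), ?_, fun A i => ?_⟩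
  · intro x hx
    fin_cases x <;> simp [free] at hx ⊢
  · rw [← hψ]
    simp only [Rz, realize_all, realize_imp, realize_eqv]
    constructor
    · intro h d1 d2 e1 e2
      simp at e1 e2
      subst e1 e2
      simpa using h
    · intro h
      simpa using h i i (by simp) (by simp)

def ofWord (M : OPM (Set AP)) (w : OPWord AP) : NC AP where
  N := w.n + 1
  ch a b := w.chi M a b
  P := wordUnI w
  len x y h := h.1
  nc x y u v h1 h2 a b c := by
    exact chain_nc _ x y u v le_rfl h1.2.2 h2.2.2 a b c

theorem ofWord_rel (M : OPM (Set AP)) (w : OPWord AP) : (ofWord M w).relI = wordRelI M w := by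
  funext r; cases r <;> rfl

end NC


end

/-- **The three-variable property** of first-order logic on finite OP words. -/
theorem fo_three_variable_property {AP : Type} (M : OPM (Set AP))
    (φ : FOV OPRel AP ℕ) (hφ : φ.free ⊆ {0}) :
    ∃ ψ : FOV OPRel AP (Fin 3), ψ.free ⊆ {0} ∧
      ∀ w : OPWord AP, w.Compatible M → ∀ i : Fin (w.n + 2),
        (φ.Realize (wordRelI M w) (wordUnI w) (fun _ => i) ↔
          ψ.Realize (wordRelI M w) (wordUnI w) (fun _ => i)) := by
  obtain ⟨ψ, h1, h2⟩ := NC.main φ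
  refine ⟨ψ, h1, fun w _ i => ?_⟩
  rw [← NC.ofWord_rel M w]
  exact h2 (NC.ofWord M w) i

end OPLTheory
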